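/- Completeness of λ_CLC: if ⟦t₁⟧ = ⟦t₂⟧ in every λ_CLC-structure (for well-formed terms t₁, t₂ of the same sort in context Γ), then Γ ⊢ t₁ ≡ t₂ is derivable in the equational theory of λ_CLC. -/

import Mathlib

universe u

/-- A renaming from `m` to `n` is a function `Fin m → Fin n`. -/
abbrev Ren (m n : ℕ) : Type := Fin m → Fin n

/-- The identity renaming. -/
def idRen (n : ℕ) : Ren n n := fun i => i

/-- Block sum of renamings. -/
def bsum {m₁ n₁ m₂ n₂ : ℕ} (r : Ren m₁ n₁) (r' : Ren m₂ n₂) : Ren (m₁ + m₂) (n₁ + n₂) :=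
  fun i => Fin.addCases (motive := fun _ => Fin (n₁ + n₂))
    (fun a => Fin.castAdd n₂ (r a)) (fun b => Fin.natAdd n₁ (r' b)) i

/-- The block swap `σ_{m,n} : m+n → n+m`. -/
def swapRen (m n : ℕ) : Ren (m + n) (n + m) :=
  fun i => Fin.addCases (motive := fun _ => Fin (n + m))
    (fun a => Fin.natAdd n a) (fun b => Fin.castAdd m b) i

/-- The copy renaming `Δ_n : n+n → n`, sending both copies of `i` to `i`. -/
def copyRen (n : ℕ) : Ren (n + n) n :=
  fun i => Fin.addCases (motive := fun _ => Fin n) (fun a => a) (fun b => b) i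

/-- The discard renaming `!_n : 0 → n` (the empty function). -/
def discardRen (n : ℕ) : Ren 0 n := fun i => i.elim0

/-- Cast along an equality of arities. -/
def acast {C : ℕ → Type u} {m n : ℕ} (h : m = n) : C m → C n := fun x => h ▸ x

/-- Cast along equalities of both arities. -/
def hcast {H : ℕ → ℕ → Type u} {a a' b b' : ℕ} (h₁ : a = a') (h₂ : b = b') : H a b → H a' b' :=
  fun f => h₂ ▸ h₁ ▸ f

/-- A preoperad: a family of sets `C n` with an identity `one ∈ C 1` and single
substitution `f{n₁ ⊣ g ⊢ n₂}`, satisfying unit and associativity laws. -/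
structure Preoperad where
  C : ℕ → Type
  one : C 1
  subst : ∀ (n₁ n₂ : ℕ) {m : ℕ}, C (n₁ + 1 + n₂) → C m → C (n₁ + m + n₂)
  left_unit : ∀ {m : ℕ} (g : C m), subst 0 0 one g = acast (C := C) (by omega) g
  right_unit : ∀ {n₁ n₂ : ℕ} (f : C (n₁ + 1 + n₂)), subst n₁ n₂ f one = f
  assoc : ∀ {m₁ m₂ n₁ n₂ k : ℕ} (f : C (m₁ + 1 + m₂)) (g : C (n₁ + 1 + n₂)) (h : C k),
    subst (m₁ + n₁) (n₂ + m₂) (acast (C := C) (by omega) (subst m₁ m₂ f g)) h =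
      acast (C := C) (by omega) (subst m₁ m₂ f (subst n₁ n₂ g h))

/-- Two elements `g₁ ∈ C k₁`, `g₂ ∈ C k₂` of a preoperad commute when substituting them
into the two distinguished inputs of any morphism in either order yields the same
result (in both orientations). -/
def Preoperad.Commute (P : Preoperad) {k₁ k₂ : ℕ} (g₁ : P.C k₁) (g₂ : P.C k₂) : Prop :=
  ∀ (m₁ m m₂ : ℕ) (f : P.C (m₁ + 1 + m + 1 + m₂)),
    (P.subst (m₁ + k₁ + m) m₂
        (acast (C := P.C) (by omega)
          (P.subst m₁ (m + 1 + m₂) (acast (C := P.C) (by omega) f) g₁)) g₂ =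
      acast (C := P.C) (by omega)
        (P.subst m₁ (m + k₂ + m₂)
          (acast (C := P.C) (by omega) (P.subst (m₁ + 1 + m) m₂ f g₂)) g₁)) ∧
    (P.subst (m₁ + k₂ + m) m₂
        (acast (C := P.C) (by omega)
          (P.subst m₁ (m + 1 + m₂) (acast (C := P.C) (by omega) f) g₂)) g₁ =
      acast (C := P.C) (by omega)
        (P.subst m₁ (m + k₁ + m₂)
          (acast (C := P.C) (by omega) (P.subst (m₁ + 1 + m) m₂ f g₁)) g₂))

/-- An element is central if it commutes with every element. -/
def Preoperad.Central (P : Preoperad) {k : ℕ} (g : P.C k) : Prop :=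
  ∀ {k' : ℕ} (g' : P.C k'), P.Commute g g'

/-- A `Ren`-cartesian preoperad: a preoperad equipped with reindexing `f[r]` along all
renamings, functorially, and satisfying the renaming–substitution interchange law. -/
structure RenPreoperad extends Preoperad where
  ren : ∀ {m n : ℕ}, C m → Ren m n → C n
  ren_id : ∀ {m : ℕ} (f : C m), ren f (idRen m) = f
  ren_comp : ∀ {m n k : ℕ} (f : C m) (r₁ : Ren m n) (r₂ : Ren n k),
    ren f (r₂ ∘ r₁) = ren (ren f r₁) r₂
  ren_subst : ∀ {n₁ n₂ k m₁ m₂ m : ℕ} (f : C (n₁ + 1 + n₂)) (g : C k)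
      (r₁ : Ren n₁ m₁) (r : Ren k m) (r₂ : Ren n₂ m₂),
    ren (subst n₁ n₂ f g) (bsum (bsum r₁ r) r₂) =
      subst m₁ m₂ (ren f (bsum (bsum r₁ (idRen 1)) r₂)) (ren g r)

/-- A symmetric `Ren`-cartesian preoperad: transpositions are natural with respect to
single substitution, in both orientations. -/
structure SymRenPreoperad extends RenPreoperad where
  sym_nat₁ : ∀ {m₁ m₂ n : ℕ} (f : C (m₁ + 2 + m₂)) (g : C n),
    subst m₁ (1 + m₂)
        (acast (C := C) (by omega)
          (ren f (bsum (bsum (idRen m₁) (swapRen 1 1)) (idRen m₂)))) g =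
      acast (C := C) (by omega)
        (ren (acast (C := C) (by omega) (subst (m₁ + 1) m₂ f g))
          (bsum (bsum (idRen m₁) (swapRen 1 n)) (idRen m₂)))
  sym_nat₂ : ∀ {m₁ m₂ n : ℕ} (f : C (m₁ + 2 + m₂)) (g : C n),
    subst (m₁ + 1) m₂
        (ren f ((bsum (bsum (idRen m₁) (swapRen 1 1)) (idRen m₂) :
          Ren (m₁ + (1 + 1) + m₂) (m₁ + (1 + 1) + m₂)))) g =
      acast (C := C) (by omega)
        (ren (acast (C := C) (by omega) (subst m₁ (1 + m₂) (acast (C := C) (by omega) f) g))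
          (bsum (bsum (idRen m₁) (swapRen n 1)) (idRen m₂)))

/-- A cartesian operad: a `Ren`-cartesian symmetric preoperad in which every element is
central and in which discard and copy are natural with respect to single substitution. -/
structure CartOperad extends SymRenPreoperad where
  central : ∀ {k : ℕ} (g : C k), toPreoperad.Central g
  discard_nat : ∀ {m₁ m₂ n : ℕ} (f : C (m₁ + 0 + m₂)) (g : C n),
    subst m₁ m₂
        (ren f ((bsum (bsum (idRen m₁) (discardRen 1)) (idRen m₂) :
          Ren (m₁ + 0 + m₂) (m₁ + 1 + m₂)))) g =
      ren f ((bsum (bsum (idRen m₁) (discardRen n)) (idRen m₂) :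
        Ren (m₁ + 0 + m₂) (m₁ + n + m₂)))
  copy_nat : ∀ {m₁ m₂ n : ℕ} (f : C (m₁ + 2 + m₂)) (g : C n),
    subst m₁ m₂
        (ren f ((bsum (bsum (idRen m₁) (copyRen 1)) (idRen m₂) :
          Ren (m₁ + (1 + 1) + m₂) (m₁ + 1 + m₂)))) g =
      ren (acast (C := C) (by omega)
            (subst m₁ (n + m₂) (acast (C := C) (by omega) (subst (m₁ + 1) m₂ f g)) g))
        ((bsum (bsum (idRen m₁) (copyRen n)) (idRen m₂) :
          Ren (m₁ + (n + n) + m₂) (m₁ + n + m₂)))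

/-- A cartesian preoperad functor: preserves the identity, single substitution and
reindexing. -/
structure RenPreoperadHom (P Q : RenPreoperad) where
  map : ∀ {n : ℕ}, P.C n → Q.C n
  map_one : map P.one = Q.one
  map_subst : ∀ {n₁ n₂ m : ℕ} (f : P.C (n₁ + 1 + n₂)) (g : P.C m),
    map (P.subst n₁ n₂ f g) = Q.subst n₁ n₂ (map f) (map g)
  map_ren : ∀ {m n : ℕ} (f : P.C m) (r : Ren m n), map (P.ren f r) = Q.ren (map f) r

/-- Composition of cartesian preoperad functors. -/
def RenPreoperadHom.comp {P Q R : RenPreoperad} (F : RenPreoperadHom P Q)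
    (G : RenPreoperadHom Q R) : RenPreoperadHom P R where
  map f := G.map (F.map f)
  map_one := by show G.map (F.map P.one) = _; rw [F.map_one, G.map_one]
  map_subst f g := by
    show G.map (F.map _) = _
    rw [F.map_subst, G.map_subst]
  map_ren f r := by
    show G.map (F.map _) = _
    rw [F.map_ren, G.map_ren]

/-- A Freyd operad: a cartesian operad `V` of values, a symmetric `Ren`-cartesian
preoperad `C` of computations, and a cartesian preoperad functor `I : V → C` whose image
consists of central elements (and hence forms a cartesian operad). -/
structure FreydOperad where
  V : CartOperad
  C : SymRenPreoperad
  I : RenPreoperadHom V.toRenPreoperad C.toRenPreoperad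
  I_central : ∀ {n : ℕ} (v : V.C n), C.toPreoperad.Central (I.map v)

/-- A Freyd operad functor: a pair of cartesian preoperad functors commuting with the
functors `I`. -/
structure FreydOperadHom (O₁ O₂ : FreydOperad) where
  mapV : RenPreoperadHom O₁.V.toRenPreoperad O₂.V.toRenPreoperad
  mapC : RenPreoperadHom O₁.C.toRenPreoperad O₂.C.toRenPreoperad
  square : ∀ {n : ℕ} (v : O₁.V.C n), mapC.map (O₁.I.map v) = O₂.I.map (mapV.map v)

/-- Composition of Freyd operad functors. -/
def FreydOperadHom.comp {O₁ O₂ O₃ : FreydOperad} (F : FreydOperadHom O₁ O₂)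
    (G : FreydOperadHom O₂ O₃) : FreydOperadHom O₁ O₃ where
  mapV := F.mapV.comp G.mapV
  mapC := F.mapC.comp G.mapC
  square v := by
    show G.mapC.map (F.mapC.map _) = _
    rw [F.square, G.square]; rfl

/-- A weakly closed Freyd operad: abstraction `λₙ : C(n+1) → V(n)` and application
`@ ∈ C 2` satisfying the β-law and compatibility of abstraction with substitution. -/
structure WCFreydOperad extends FreydOperad where
  abs : ∀ {n : ℕ}, C.C (n + 1) → V.C n
  app : C.C 2
  beta : ∀ {n : ℕ} (f : C.C (n + 1)),
    C.subst 0 1 app (I.map (abs f)) = acast (C := C.C) (by omega) f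
  abs_subst : ∀ {m₁ m₂ k : ℕ} (f : C.C (m₁ + 1 + (m₂ + 1))) (v : V.C k),
    abs (acast (C := C.C) (by omega) (C.subst m₁ (m₂ + 1) f (I.map v))) =
      V.subst m₁ m₂ (abs (acast (C := C.C) (by omega) f)) v

/-- A signature: function symbols and procedure symbols, each with an arity. -/
structure Sig where
  Func : Type
  fArity : Func → ℕ
  Proc : Type
  pArity : Proc → ℕ

mutual
/-- Values of λ_CLC, well formed in a context `x₁, …, xₙ` (de Bruijn presentation):
variables, function-symbol applications, and λ-abstractions. -/
inductive DVal (Sg : Sig) : ℕ → Type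
  | var {n : ℕ} (i : Fin n) : DVal Sg n
  | func {n : ℕ} (f : Sg.Func) (args : Fin (Sg.fArity f) → DVal Sg n) : DVal Sg n
  | lam {n : ℕ} (M : DCmp Sg (n + 1)) : DVal Sg n

/-- Computations of λ_CLC, well formed in a context `x₁, …, xₙ`: returned values,
sequencing `let x = M₁ in M₂`, procedure-symbol applications, and applications. -/
inductive DCmp (Sg : Sig) : ℕ → Type
  | ret {n : ℕ} (W : DVal Sg n) : DCmp Sg n
  | letin {n : ℕ} (M₁ : DCmp Sg n) (M₂ : DCmp Sg (n + 1)) : DCmp Sg n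
  | proc {n : ℕ} (p : Sg.Proc) (args : Fin (Sg.pArity p) → DVal Sg n) : DCmp Sg n
  | app {n : ℕ} (V₁ V₂ : DVal Sg n) : DCmp Sg n
end

/-- Lift a renaming under a binder. -/
def liftRen {m n : ℕ} (r : Fin m → Fin n) : Fin (m + 1) → Fin (n + 1) :=
  fun i => Fin.lastCases (Fin.last n) (fun j => (r j).castSucc) i

mutual
/-- Rename the free variables of a value. -/
def renameV {Sg : Sig} : ∀ {m n : ℕ}, DVal Sg m → (Fin m → Fin n) → DVal Sg n
  | _, _, .var i, r => .var (r i)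
  | _, _, .func f args, r => .func f (fun i => renameV (args i) r)
  | _, _, .lam M, r => .lam (renameC M (liftRen r))

/-- Rename the free variables of a computation. -/
def renameC {Sg : Sig} : ∀ {m n : ℕ}, DCmp Sg m → (Fin m → Fin n) → DCmp Sg n
  | _, _, .ret W, r => .ret (renameV W r)
  | _, _, .letin M₁ M₂, r => .letin (renameC M₁ r) (renameC M₂ (liftRen r))
  | _, _, .proc p args, r => .proc p (fun i => renameV (args i) r)
  | _, _, .app V₁ V₂, r => .app (renameV V₁ r) (renameV V₂ r)
end

/-- Lift a simultaneous substitution under a binder. -/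
def liftSub {Sg : Sig} {m n : ℕ} (σ : Fin m → DVal Sg n) : Fin (m + 1) → DVal Sg (n + 1) :=
  fun i => Fin.lastCases (.var (Fin.last n)) (fun j => renameV (σ j) Fin.castSucc) i

mutual
/-- Capture-avoiding simultaneous substitution of values for the free variables of a
value. -/
def substV {Sg : Sig} : ∀ {m n : ℕ}, DVal Sg m → (Fin m → DVal Sg n) → DVal Sg n
  | _, _, .var i, σ => σ i
  | _, _, .func f args, σ => .func f (fun i => substV (args i) σ)
  | _, _, .lam M, σ => .lam (substC M (liftSub σ))

/-- Capture-avoiding simultaneous substitution of values for the free variables of a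
computation. -/
def substC {Sg : Sig} : ∀ {m n : ℕ}, DCmp Sg m → (Fin m → DVal Sg n) → DCmp Sg n
  | _, _, .ret W, σ => .ret (substV W σ)
  | _, _, .letin M₁ M₂, σ => .letin (substC M₁ σ) (substC M₂ (liftSub σ))
  | _, _, .proc p args, σ => .proc p (fun i => substV (args i) σ)
  | _, _, .app V₁ V₂, σ => .app (substV V₁ σ) (substV V₂ σ)
end

/-- Length of the concatenation of a family of contexts with sizes `k 0, …, k (n-1)`. -/
def finSum : ∀ {n : ℕ}, (Fin n → ℕ) → ℕ
  | 0, _ => 0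
  | n + 1, k => finSum (fun i => k i.castSucc) + k (Fin.last n)

/-- The embedding of the `i`-th block into the concatenation of blocks of sizes `k`. -/
def blockInj : ∀ {n : ℕ} (k : Fin n → ℕ) (i : Fin n), Fin (k i) → Fin (finSum k)
  | n + 1, k, i =>
      Fin.lastCases (motive := fun i => Fin (k i) → Fin (finSum k))
        (fun a => Fin.natAdd (finSum fun j => k j.castSucc) a)
        (fun j a => Fin.castAdd (k (Fin.last n)) (blockInj (fun j => k j.castSucc) j a))
        i

/-- Case analysis on the concatenation of blocks of sizes `k`. -/
def finSumCases : ∀ {n : ℕ} (k : Fin n → ℕ) {α : Sort _},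
    (∀ i, Fin (k i) → α) → Fin (finSum k) → α
  | 0, _, _, _, j => j.elim0
  | n + 1, k, _, h, j =>
      Fin.addCases (fun a => finSumCases (fun i => k i.castSucc) (fun i => h i.castSucc) a)
        (fun b => h (Fin.last n) b) j

/-- Iterated (parallel) substitution, with a fixed trailing block of size `t`. -/
def Preoperad.psubAux (P : Preoperad) :
    ∀ {n : ℕ} (k : Fin n → ℕ) (t : ℕ), P.C (n + t) → (∀ i, P.C (k i)) → P.C (finSum k + t)
  | 0, _, _, f, _ => f
  | n + 1, k, t, f, g =>
      acast (C := P.C)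
        (by simp only [finSum]; omega)
        (P.psubAux (fun i => k i.castSucc) (k (Fin.last n) + t)
          (acast (C := P.C) (by omega) (P.subst n t f (g (Fin.last n))))
          (fun i => g i.castSucc))

/-- Parallel substitution of the elements `g i ∈ C (k i)` into the `n` inputs of
`f ∈ C n` (performed sequentially; when the `g i` are central the order is
irrelevant). -/
def Preoperad.psub (P : Preoperad) {n : ℕ} (k : Fin n → ℕ) (f : P.C n)
    (g : ∀ i, P.C (k i)) : P.C (finSum k) :=
  P.psubAux k 0 f g

/-- A λ_CLC-structure over a signature: a weakly closed Freyd operad together with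
interpretations of all function and procedure symbols. -/
structure CLCStructure (Sg : Sig) where
  O : WCFreydOperad
  Ff : ∀ f : Sg.Func, O.V.C (Sg.fArity f)
  Pp : ∀ p : Sg.Proc, O.C.C (Sg.pArity p)

mutual
/-- Interpretation of values in a λ_CLC-structure: a variable is the identity reindexed
along discards, function applications are parallel substitutions into the interpretation
of the symbol (followed by contraction of the shared context), and abstractions are
interpreted by the weak closure. -/
def interpV {Sg : Sig} (S : CLCStructure Sg) : ∀ {n : ℕ}, DVal Sg n → S.O.V.C n
  | n, .var i => S.O.V.ren S.O.V.one (fun _ => i)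
  | n, .func f args =>
      S.O.V.ren
        (S.O.V.toPreoperad.psub (fun _ => n) (S.Ff f) (fun i => interpV S (args i)))
        (finSumCases (fun _ => n) (fun _ a => a))
  | _, .lam M => S.O.abs (interpC S M)

/-- Interpretation of computations in a λ_CLC-structure: `return` is interpreted by `I`,
`let` by single substitution in `C` (followed by contraction of the shared context),
procedure applications like function applications, and application via the weak
closure's application element. -/
def interpC {Sg : Sig} (S : CLCStructure Sg) : ∀ {n : ℕ}, DCmp Sg n → S.O.C.C n
  | _, .ret W => S.O.I.map (interpV S W)
  | n, .letin M₁ M₂ =>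
      S.O.C.ren (S.O.C.subst n 0 (interpC S M₂) (interpC S M₁)) (copyRen n)
  | n, .proc p args =>
      S.O.C.ren
        (S.O.C.toPreoperad.psub (fun _ => n) (S.Pp p)
          (fun i => S.O.I.map (interpV S (args i))))
        (finSumCases (fun _ => n) (fun _ a => a))
  | n, .app V₁ V₂ =>
      S.O.C.ren
        (S.O.C.toPreoperad.psub (fun _ : Fin 2 => n) S.O.app
          (fun i => S.O.I.map (Fin.cases (interpV S V₁) (fun _ => interpV S V₂) i)))
        (finSumCases (fun _ : Fin 2 => n) (fun _ a => a))
end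

/-- The single substitution `[x := W]` of a value for the last variable. -/
def sub1 {Sg : Sig} {n : ℕ} (W : DVal Sg n) : Fin (n + 1) → DVal Sg n :=
  fun i => Fin.lastCases W (fun j => .var j) i

/-- Weakening inserting a fresh variable just below the last one. -/
def midWeak (n : ℕ) : Fin (n + 1) → Fin (n + 2) :=
  fun i => Fin.lastCases (Fin.last (n + 1)) (fun j => j.castSucc.castSucc) i

mutual
/-- The equational theory of λ_CLC on values: the least congruence containing the
axioms (lunit), (runit), (assoc) and (beta). -/
inductive EqV (Sg : Sig) : {n : ℕ} → DVal Sg n → DVal Sg n → Prop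
  | refl {n : ℕ} (V : DVal Sg n) : EqV Sg V V
  | symm {n : ℕ} {V₁ V₂ : DVal Sg n} : EqV Sg V₁ V₂ → EqV Sg V₂ V₁
  | trans {n : ℕ} {V₁ V₂ V₃ : DVal Sg n} : EqV Sg V₁ V₂ → EqV Sg V₂ V₃ → EqV Sg V₁ V₃
  | func {n : ℕ} (f : Sg.Func) {args args' : Fin (Sg.fArity f) → DVal Sg n} :
      (∀ i, EqV Sg (args i) (args' i)) → EqV Sg (.func f args) (.func f args')
  | lam {n : ℕ} {M M' : DCmp Sg (n + 1)} : EqC Sg M M' → EqV Sg (.lam M) (.lam M')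

/-- The equational theory of λ_CLC on computations. -/
inductive EqC (Sg : Sig) : {n : ℕ} → DCmp Sg n → DCmp Sg n → Prop
  | refl {n : ℕ} (M : DCmp Sg n) : EqC Sg M M
  | symm {n : ℕ} {M₁ M₂ : DCmp Sg n} : EqC Sg M₁ M₂ → EqC Sg M₂ M₁
  | trans {n : ℕ} {M₁ M₂ M₃ : DCmp Sg n} : EqC Sg M₁ M₂ → EqC Sg M₂ M₃ → EqC Sg M₁ M₃
  | ret {n : ℕ} {W W' : DVal Sg n} : EqV Sg W W' → EqC Sg (.ret W) (.ret W')
  | letin {n : ℕ} {M₁ M₁' : DCmp Sg n} {M₂ M₂' : DCmp Sg (n + 1)} :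
      EqC Sg M₁ M₁' → EqC Sg M₂ M₂' → EqC Sg (.letin M₁ M₂) (.letin M₁' M₂')
  | proc {n : ℕ} (p : Sg.Proc) {args args' : Fin (Sg.pArity p) → DVal Sg n} :
      (∀ i, EqV Sg (args i) (args' i)) → EqC Sg (.proc p args) (.proc p args')
  | app {n : ℕ} {V₁ V₁' V₂ V₂' : DVal Sg n} :
      EqV Sg V₁ V₁' → EqV Sg V₂ V₂' → EqC Sg (.app V₁ V₂) (.app V₁' V₂')
  /-- (lunit) `let x = return W in M ≡ M[x := W]` -/
  | lunit {n : ℕ} (W : DVal Sg n) (M : DCmp Sg (n + 1)) :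
      EqC Sg (.letin (.ret W) M) (substC M (sub1 W))
  /-- (runit) `let x = M in return x ≡ M` -/
  | runit {n : ℕ} (M : DCmp Sg n) :
      EqC Sg (.letin M (.ret (.var (Fin.last n)))) M
  /-- (assoc) `let y = (let x = M₁ in M₂) in M ≡ let x = M₁ in (let y = M₂ in M)` -/
  | assoc {n : ℕ} (M₁ : DCmp Sg n) (M₂ : DCmp Sg (n + 1)) (M : DCmp Sg (n + 1)) :
      EqC Sg (.letin (.letin M₁ M₂) M)
        (.letin M₁ (.letin M₂ (renameC M (midWeak n))))
  /-- (beta) `(λx.M) W ≡ M[x := W]` -/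
  | beta {n : ℕ} (M : DCmp Sg (n + 1)) (W : DVal Sg n) :
      EqC Sg (.app (.lam M) W) (substC M (sub1 W))
end

/-- Embedding of the left block `n₁` into `n₁ + m + n₂`. -/
def embL (n₁ m n₂ : ℕ) : Fin n₁ → Fin (n₁ + m + n₂) :=
  fun j => Fin.castAdd n₂ (Fin.castAdd m j)

/-- Embedding of the middle block `m` into `n₁ + m + n₂`. -/
def embM (n₁ m n₂ : ℕ) : Fin m → Fin (n₁ + m + n₂) :=
  fun a => Fin.castAdd n₂ (Fin.natAdd n₁ a)

/-- Embedding of the right block `n₂` into `n₁ + m + n₂`. -/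
def embR (n₁ m n₂ : ℕ) : Fin n₂ → Fin (n₁ + m + n₂) :=
  fun z => Fin.natAdd (n₁ + m) z

/-- The simultaneous substitution replacing the distinguished middle variable of
`n₁ + 1 + n₂` by `V₂` (placed in the middle block) and renaming the other variables
accordingly. -/
def midSubst {Sg : Sig} (n₁ n₂ : ℕ) {m : ℕ} (V₂ : DVal Sg m) :
    Fin (n₁ + 1 + n₂) → DVal Sg (n₁ + m + n₂) :=
  fun i =>
    Fin.addCases (motive := fun _ => DVal Sg (n₁ + m + n₂))
      (fun j : Fin (n₁ + 1) =>
        Fin.lastCases (renameV V₂ (embM n₁ m n₂)) (fun j' => .var (embL n₁ m n₂ j')) j)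
      (fun z : Fin n₂ => .var (embR n₁ m n₂ z)) i

/-- Single substitution of a value into the distinguished middle variable of a value. -/
def tsubV {Sg : Sig} (n₁ n₂ : ℕ) {m : ℕ} (V₁ : DVal Sg (n₁ + 1 + n₂)) (V₂ : DVal Sg m) :
    DVal Sg (n₁ + m + n₂) :=
  substV V₁ (midSubst n₁ n₂ V₂)

/-- Renaming sending the distinguished middle variable of `n₁ + 1 + n₂` to the last
variable of `(n₁ + m + n₂) + 1` and the remaining variables to the corresponding
blocks. -/
def midToLast (n₁ n₂ m : ℕ) : Fin (n₁ + 1 + n₂) → Fin (n₁ + m + n₂ + 1) :=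
  fun i =>
    Fin.addCases (motive := fun _ => Fin (n₁ + m + n₂ + 1))
      (fun j : Fin (n₁ + 1) =>
        Fin.lastCases (Fin.last (n₁ + m + n₂)) (fun j' => (embL n₁ m n₂ j').castSucc) j)
      (fun z : Fin n₂ => (embR n₁ m n₂ z).castSucc) i

/-- Single substitution of a computation into the distinguished middle variable of a
computation, given by sequencing: `let y = M₂ in M₁`. -/
def tletC {Sg : Sig} (n₁ n₂ : ℕ) {m : ℕ} (M₁ : DCmp Sg (n₁ + 1 + n₂)) (M₂ : DCmp Sg m) :
    DCmp Sg (n₁ + m + n₂) :=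
  .letin (renameC M₂ (embM n₁ m n₂)) (renameC M₁ (midToLast n₁ n₂ m))

/-- `S` is a term model of λ_CLC: its carriers are equivalence classes of well-formed
terms modulo provable equality, with single substitution given by value substitution
(resp. `let`-sequencing), reindexing by syntactic renaming, `I` by `return`, abstraction
by `λ`, application by the class of `x₁ x₂`, and symbol interpretations by their
canonical terms. -/
def IsTermModel {Sg : Sig} (S : CLCStructure Sg)
    (eV : ∀ n : ℕ, S.O.V.C n ≃ Quot (@EqV Sg n)) (eC : ∀ n : ℕ, S.O.C.C n ≃ Quot (@EqC Sg n)) :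
    Prop :=
  (eV 1 S.O.V.one = Quot.mk _ (.var 0)) ∧
  (eC 1 S.O.C.one = Quot.mk _ (.ret (.var 0))) ∧
  (∀ {n₁ n₂ m : ℕ} (V₁ : DVal Sg (n₁ + 1 + n₂)) (V₂ : DVal Sg m),
    eV _ (S.O.V.subst n₁ n₂ ((eV _).symm (Quot.mk _ V₁)) ((eV _).symm (Quot.mk _ V₂))) =
      Quot.mk _ (tsubV n₁ n₂ V₁ V₂)) ∧
  (∀ {n₁ n₂ m : ℕ} (M₁ : DCmp Sg (n₁ + 1 + n₂)) (M₂ : DCmp Sg m),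
    eC _ (S.O.C.subst n₁ n₂ ((eC _).symm (Quot.mk _ M₁)) ((eC _).symm (Quot.mk _ M₂))) =
      Quot.mk _ (tletC n₁ n₂ M₁ M₂)) ∧
  (∀ {m n : ℕ} (V : DVal Sg m) (r : Ren m n),
    eV _ (S.O.V.ren ((eV _).symm (Quot.mk _ V)) r) = Quot.mk _ (renameV V r)) ∧
  (∀ {m n : ℕ} (M : DCmp Sg m) (r : Ren m n),
    eC _ (S.O.C.ren ((eC _).symm (Quot.mk _ M)) r) = Quot.mk _ (renameC M r)) ∧
  (∀ {n : ℕ} (V : DVal Sg n),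
    eC _ (S.O.I.map ((eV _).symm (Quot.mk _ V))) = Quot.mk _ (.ret V)) ∧
  (∀ {n : ℕ} (M : DCmp Sg (n + 1)),
    eV _ (S.O.abs ((eC _).symm (Quot.mk _ M))) = Quot.mk _ (.lam M)) ∧
  (eC 2 S.O.app = Quot.mk _ (.app (.var 0) (.var 1))) ∧
  (∀ f : Sg.Func, eV _ (S.Ff f) = Quot.mk _ (.func f (fun i => .var i))) ∧
  (∀ p : Sg.Proc, eC _ (S.Pp p) = Quot.mk _ (.proc p (fun i => .var i)))

/-- A morphism of λ_CLC-structures: a pair of cartesian preoperad functors commuting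
with the functors `I`, preserving abstraction and application, and preserving the
interpretations of all function and procedure symbols. -/
structure CLCHom {Sg : Sig} (S₁ S₂ : CLCStructure Sg) where
  mapV : RenPreoperadHom S₁.O.V.toRenPreoperad S₂.O.V.toRenPreoperad
  mapC : RenPreoperadHom S₁.O.C.toRenPreoperad S₂.O.C.toRenPreoperad
  squareI : ∀ {n : ℕ} (v : S₁.O.V.C n), mapC.map (S₁.O.I.map v) = S₂.O.I.map (mapV.map v)
  mapAbs : ∀ {n : ℕ} (f : S₁.O.C.C (n + 1)), mapV.map (S₁.O.abs f) = S₂.O.abs (mapC.map f)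
  mapApp : mapC.map S₁.O.app = S₂.O.app
  mapFf : ∀ f : Sg.Func, mapV.map (S₁.Ff f) = S₂.Ff f
  mapPp : ∀ p : Sg.Proc, mapC.map (S₁.Pp p) = S₂.Pp p

@[simp] theorem liftRen_castSucc {m n : ℕ} (r : Fin m → Fin n) (i : Fin m) :
    liftRen r i.castSucc = (r i).castSucc := by simp [liftRen]

@[simp] theorem liftRen_last {m n : ℕ} (r : Fin m → Fin n) :
    liftRen r (Fin.last m) = Fin.last n := by simp [liftRen]

@[simp] theorem liftRen_id (n : ℕ) : liftRen (fun i : Fin n => i) = fun i => i := by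
  funext i
  induction i using Fin.lastCases <;> simp

section Substitution

variable {Sg : Sig}

@[simp] theorem liftSub_castSucc {m n : ℕ} (σ : Fin m → DVal Sg n) (i : Fin m) :
    liftSub σ i.castSucc = renameV (σ i) Fin.castSucc := by simp [liftSub]

@[simp] theorem liftSub_last {m n : ℕ} (σ : Fin m → DVal Sg n) :
    liftSub σ (Fin.last m) = .var (Fin.last n) := by simp [liftSub]

theorem liftSub_var {m n : ℕ} (r : Fin m → Fin n) :
    liftSub (fun i => DVal.var (Sg := Sg) (r i)) = fun i => .var (liftRen r i) := by
  funext i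
  induction i using Fin.lastCases <;> simp [renameV]

@[simp] theorem liftSub_var_id (n : ℕ) :
    liftSub (fun i : Fin n => DVal.var (Sg := Sg) i) = fun i => .var i := by
  rw [liftSub_var fun i => i, liftRen_id]

theorem liftSub_comp_liftRen {m n k : ℕ} (r : Fin m → Fin n) (σ : Fin n → DVal Sg k) :
    liftSub σ ∘ liftRen r = liftSub (σ ∘ r) := by
  funext i
  induction i using Fin.lastCases <;> simp

mutual
theorem renameV_eq_substV : ∀ {m n : ℕ} (V : DVal Sg m) (r : Fin m → Fin n),
    renameV V r = substV V (fun i => .var (r i))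
  | _, _, .var i, r => by simp [renameV, substV]
  | _, _, .func f args, r => by
    simp only [renameV, substV]
    congr 1
    funext i
    exact renameV_eq_substV (args i) r
  | _, _, .lam M, r => by
    simp only [renameV, substV, liftSub_var]
    rw [renameC_eq_substC M]

theorem renameC_eq_substC : ∀ {m n : ℕ} (M : DCmp Sg m) (r : Fin m → Fin n),
    renameC M r = substC M (fun i => .var (r i))
  | _, _, .ret W, r => by
    simp only [renameC, substC]
    rw [renameV_eq_substV W]
  | _, _, .letin M₁ M₂, r => by
    simp only [renameC, substC, liftSub_var]
    rw [renameC_eq_substC M₁, renameC_eq_substC M₂]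
  | _, _, .proc p args, r => by
    simp only [renameC, substC]
    congr 1
    funext i
    exact renameV_eq_substV (args i) r
  | _, _, .app V₁ V₂, r => by
    simp only [renameC, substC]
    rw [renameV_eq_substV V₁, renameV_eq_substV V₂]
end

mutual
@[simp] theorem substV_var : ∀ {n : ℕ} (V : DVal Sg n), substV V (fun i => .var i) = V
  | _, .var i => by simp [substV]
  | _, .func f args => by
    simp only [substV]
    congr 1
    funext i
    exact substV_var (args i)
  | _, .lam M => by
    simp only [substV, liftSub_var_id]
    rw [substC_var M]

@[simp] theorem substC_var : ∀ {n : ℕ} (M : DCmp Sg n), substC M (fun i => .var i) = M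
  | _, .ret W => by
    simp only [substC]
    rw [substV_var W]
  | _, .letin M₁ M₂ => by
    simp only [substC, liftSub_var_id]
    rw [substC_var M₁, substC_var M₂]
  | _, .proc p args => by
    simp only [substC]
    congr 1
    funext i
    exact substV_var (args i)
  | _, .app V₁ V₂ => by
    simp only [substC]
    rw [substV_var V₁, substV_var V₂]
end

mutual
theorem substV_renameV : ∀ {m n k : ℕ} (V : DVal Sg m) (r : Fin m → Fin n)
    (σ : Fin n → DVal Sg k), substV (renameV V r) σ = substV V (σ ∘ r)
  | _, _, _, .var i, r, σ => by simp [renameV, substV]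
  | _, _, _, .func f args, r, σ => by
    simp only [renameV, substV]
    congr 1
    funext i
    exact substV_renameV (args i) r σ
  | _, _, _, .lam M, r, σ => by
    simp only [renameV, substV]
    rw [substC_renameC M, liftSub_comp_liftRen]

theorem substC_renameC : ∀ {m n k : ℕ} (M : DCmp Sg m) (r : Fin m → Fin n)
    (σ : Fin n → DVal Sg k), substC (renameC M r) σ = substC M (σ ∘ r)
  | _, _, _, .ret W, r, σ => by
    simp only [renameC, substC]
    rw [substV_renameV W]
  | _, _, _, .letin M₁ M₂, r, σ => by
    simp only [renameC, substC]
    rw [substC_renameC M₁, substC_renameC M₂, liftSub_comp_liftRen]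
  | _, _, _, .proc p args, r, σ => by
    simp only [renameC, substC]
    congr 1
    funext i
    exact substV_renameV (args i) r σ
  | _, _, _, .app V₁ V₂, r, σ => by
    simp only [renameC, substC]
    rw [substV_renameV V₁, substV_renameV V₂]
end

theorem renameV_renameV {m n k : ℕ} (V : DVal Sg m) (r : Fin m → Fin n) (s : Fin n → Fin k) :
    renameV (renameV V r) s = renameV V (s ∘ r) := by
  rw [renameV_eq_substV, substV_renameV, renameV_eq_substV]
  rfl

theorem renameC_renameC {m n k : ℕ} (M : DCmp Sg m) (r : Fin m → Fin n) (s : Fin n → Fin k) :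
    renameC (renameC M r) s = renameC M (s ∘ r) := by
  rw [renameC_eq_substC, substC_renameC, renameC_eq_substC]
  rfl

@[simp] theorem renameV_id {n : ℕ} (V : DVal Sg n) : renameV V (fun i => i) = V := by
  rw [renameV_eq_substV, substV_var]

@[simp] theorem renameC_id {n : ℕ} (M : DCmp Sg n) : renameC M (fun i => i) = M := by
  rw [renameC_eq_substC, substC_var]

theorem renameV_liftSub {m n k : ℕ} (σ : Fin m → DVal Sg n) (r : Fin n → Fin k) :
    (fun i => renameV (liftSub σ i) (liftRen r)) = liftSub (fun i => renameV (σ i) r) := by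
  funext i
  induction i using Fin.lastCases with
  | last => simp [renameV]
  | cast i =>
    simp only [liftSub_castSucc, renameV_renameV]
    congr 1
    funext j
    simp

mutual
theorem renameV_substV : ∀ {m n k : ℕ} (V : DVal Sg m) (σ : Fin m → DVal Sg n)
    (r : Fin n → Fin k), renameV (substV V σ) r = substV V (fun i => renameV (σ i) r)
  | _, _, _, .var i, σ, r => by simp [substV]
  | _, _, _, .func f args, σ, r => by
    simp only [renameV, substV]
    congr 1
    funext i
    exact renameV_substV (args i) σ r
  | _, _, _, .lam M, σ, r => by
    simp only [renameV, substV]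
    rw [renameC_substC M, renameV_liftSub]

theorem renameC_substC : ∀ {m n k : ℕ} (M : DCmp Sg m) (σ : Fin m → DVal Sg n)
    (r : Fin n → Fin k), renameC (substC M σ) r = substC M (fun i => renameV (σ i) r)
  | _, _, _, .ret W, σ, r => by
    simp only [renameC, substC]
    rw [renameV_substV W]
  | _, _, _, .letin M₁ M₂, σ, r => by
    simp only [renameC, substC]
    rw [renameC_substC M₁, renameC_substC M₂, renameV_liftSub]
  | _, _, _, .proc p args, σ, r => by
    simp only [renameC, substC]
    congr 1
    funext i
    exact renameV_substV (args i) σ r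
  | _, _, _, .app V₁ V₂, σ, r => by
    simp only [renameC, substC]
    rw [renameV_substV V₁, renameV_substV V₂]
end

theorem substV_liftSub {m n k : ℕ} (σ : Fin m → DVal Sg n) (τ : Fin n → DVal Sg k) :
    (fun i => substV (liftSub σ i) (liftSub τ)) = liftSub (fun i => substV (σ i) τ) := by
  funext i
  induction i using Fin.lastCases with
  | last => simp [substV]
  | cast i =>
    simp only [liftSub_castSucc, substV_renameV, renameV_substV]
    congr 1
    funext j
    simp

mutual
theorem substV_substV : ∀ {m n k : ℕ} (V : DVal Sg m) (σ : Fin m → DVal Sg n)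
    (τ : Fin n → DVal Sg k), substV (substV V σ) τ = substV V (fun i => substV (σ i) τ)
  | _, _, _, .var i, σ, τ => by simp [substV]
  | _, _, _, .func f args, σ, τ => by
    simp only [substV]
    congr 1
    funext i
    exact substV_substV (args i) σ τ
  | _, _, _, .lam M, σ, τ => by
    simp only [substV]
    rw [substC_substC M, substV_liftSub]

theorem substC_substC : ∀ {m n k : ℕ} (M : DCmp Sg m) (σ : Fin m → DVal Sg n)
    (τ : Fin n → DVal Sg k), substC (substC M σ) τ = substC M (fun i => substV (σ i) τ)
  | _, _, _, .ret W, σ, τ => by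
    simp only [substC]
    rw [substV_substV W]
  | _, _, _, .letin M₁ M₂, σ, τ => by
    simp only [substC]
    rw [substC_substC M₁, substC_substC M₂, substV_liftSub]
  | _, _, _, .proc p args, σ, τ => by
    simp only [substC]
    congr 1
    funext i
    exact substV_substV (args i) σ τ
  | _, _, _, .app V₁ V₂, σ, τ => by
    simp only [substC]
    rw [substV_substV V₁, substV_substV V₂]
end

@[simp] theorem sub1_castSucc {n : ℕ} (W : DVal Sg n) (i : Fin n) :
    sub1 W i.castSucc = .var i := by simp [sub1]

@[simp] theorem sub1_last {n : ℕ} (W : DVal Sg n) : sub1 W (Fin.last n) = W := by simp [sub1]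

@[simp] theorem midWeak_castSucc (n : ℕ) (i : Fin n) :
    midWeak n i.castSucc = i.castSucc.castSucc := by simp [midWeak]

@[simp] theorem midWeak_last (n : ℕ) : midWeak n (Fin.last n) = Fin.last (n + 1) := by
  simp [midWeak]

theorem substC_sub1_substC {m n : ℕ} (M : DCmp Sg (m + 1)) (W : DVal Sg m)
    (σ : Fin m → DVal Sg n) :
    substC (substC M (liftSub σ)) (sub1 (substV W σ)) = substC (substC M (sub1 W)) σ := by
  rw [substC_substC, substC_substC]
  congr 1
  funext i
  induction i using Fin.lastCases with
  | last => simp [substV]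
  | cast i =>
    simp only [liftSub_castSucc, substV_renameV, sub1_castSucc, substV]
    conv_rhs => rw [← substV_var (σ i)]
    congr 1
    funext j
    simp

theorem substC_midWeak {m n : ℕ} (M : DCmp Sg (m + 1)) (σ : Fin m → DVal Sg n) :
    substC (renameC M (midWeak m)) (liftSub (liftSub σ)) =
      renameC (substC M (liftSub σ)) (midWeak n) := by
  rw [substC_renameC, renameC_substC]
  congr 1
  funext i
  induction i using Fin.lastCases with
  | last => simp [renameV]
  | cast i =>
    simp only [liftSub_castSucc, renameV_renameV, Function.comp_apply, midWeak_castSucc]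
    congr 1
    funext j
    simp

mutual
theorem EqV.subst : ∀ {m n : ℕ} {V V' : DVal Sg m}, EqV Sg V V' → ∀ σ : Fin m → DVal Sg n,
    EqV Sg (substV V σ) (substV V' σ)
  | _, _, _, _, .refl _, _ => .refl _
  | _, _, _, _, .symm h, σ => .symm (EqV.subst h σ)
  | _, _, _, _, .trans h₁ h₂, σ => .trans (EqV.subst h₁ σ) (EqV.subst h₂ σ)
  | _, _, _, _, .func f h, σ => by
    simp only [substV]
    exact .func f fun i => EqV.subst (h i) σ
  | _, _, _, _, .lam h, σ => by
    simp only [substV]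
    exact .lam (EqC.subst h _)

theorem EqC.subst : ∀ {m n : ℕ} {M M' : DCmp Sg m}, EqC Sg M M' → ∀ σ : Fin m → DVal Sg n,
    EqC Sg (substC M σ) (substC M' σ)
  | _, _, _, _, .refl _, _ => .refl _
  | _, _, _, _, .symm h, σ => .symm (EqC.subst h σ)
  | _, _, _, _, .trans h₁ h₂, σ => .trans (EqC.subst h₁ σ) (EqC.subst h₂ σ)
  | _, _, _, _, .ret h, σ => by
    simp only [substC]
    exact .ret (EqV.subst h σ)
  | _, _, _, _, .letin h₁ h₂, σ => by
    simp only [substC]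
    exact .letin (EqC.subst h₁ σ) (EqC.subst h₂ _)
  | _, _, _, _, .proc p h, σ => by
    simp only [substC]
    exact .proc p fun i => EqV.subst (h i) σ
  | _, _, _, _, .app h₁ h₂, σ => by
    simp only [substC]
    exact .app (EqV.subst h₁ σ) (EqV.subst h₂ σ)
  | _, _, _, _, .lunit W M, σ => by
    simp only [substC]
    rw [← substC_sub1_substC]
    exact .lunit _ _
  | _, _, _, _, .runit M, σ => by
    simp only [substC, substV, liftSub_last]
    exact .runit _
  | _, _, _, _, .assoc M₁ M₂ M, σ => by
    simp only [substC, substC_midWeak]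
    exact .assoc _ _ _
  | _, _, _, _, .beta M W, σ => by
    simp only [substC, substV]
    rw [← substC_sub1_substC]
    exact .beta _ _
end

theorem EqV.rename {m n : ℕ} {V V' : DVal Sg m} (h : EqV Sg V V') (r : Fin m → Fin n) :
    EqV Sg (renameV V r) (renameV V' r) := by
  rw [renameV_eq_substV, renameV_eq_substV]
  exact h.subst _

theorem EqC.rename {m n : ℕ} {M M' : DCmp Sg m} (h : EqC Sg M M') (r : Fin m → Fin n) :
    EqC Sg (renameC M r) (renameC M' r) := by
  rw [renameC_eq_substC, renameC_eq_substC]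
  exact h.subst _

theorem EqV.lift {m n : ℕ} {σ σ' : Fin m → DVal Sg n} (h : ∀ i, EqV Sg (σ i) (σ' i)) (i) :
    EqV Sg (liftSub σ i) (liftSub σ' i) := by
  induction i using Fin.lastCases with
  | last => simpa using .refl _
  | cast i => simpa using (h i).rename _

mutual
theorem EqV.subst_right : ∀ {m n : ℕ} (V : DVal Sg m) {σ σ' : Fin m → DVal Sg n},
    (∀ i, EqV Sg (σ i) (σ' i)) → EqV Sg (substV V σ) (substV V σ')
  | _, _, .var i, _, _, h => by
    simp only [substV]
    exact h i
  | _, _, .func f args, _, _, h => by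
    simp only [substV]
    exact .func f fun i => EqV.subst_right (args i) h
  | _, _, .lam M, _, _, h => by
    simp only [substV]
    exact .lam (EqC.subst_right M (EqV.lift h))

theorem EqC.subst_right : ∀ {m n : ℕ} (M : DCmp Sg m) {σ σ' : Fin m → DVal Sg n},
    (∀ i, EqV Sg (σ i) (σ' i)) → EqC Sg (substC M σ) (substC M σ')
  | _, _, .ret W, _, _, h => by
    simp only [substC]
    exact .ret (EqV.subst_right W h)
  | _, _, .letin M₁ M₂, _, _, h => by
    simp only [substC]
    exact .letin (EqC.subst_right M₁ h) (EqC.subst_right M₂ (EqV.lift h))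
  | _, _, .proc p args, _, _, h => by
    simp only [substC]
    exact .proc p fun i => EqV.subst_right (args i) h
  | _, _, .app V₁ V₂, _, _, h => by
    simp only [substC]
    exact .app (EqV.subst_right V₁ h) (EqV.subst_right V₂ h)
end

end Substitution

theorem bsum_val {m₁ n₁ m₂ n₂ : ℕ} (r : Ren m₁ n₁) (r' : Ren m₂ n₂) (i : Fin (m₁ + m₂)) :
    (bsum r r' i).val =
      if h : i.val < m₁ then (r ⟨i, h⟩).val else n₁ + (r' ⟨i - m₁, by omega⟩).val := by
  unfold bsum
  induction i using Fin.addCases <;> simp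

@[simp] theorem bsum_castAdd {m₁ n₁ m₂ n₂ : ℕ} (r : Ren m₁ n₁) (r' : Ren m₂ n₂) (i : Fin m₁) :
    bsum r r' (Fin.castAdd m₂ i) = Fin.castAdd n₂ (r i) := by simp [bsum]

@[simp] theorem bsum_natAdd {m₁ n₁ m₂ n₂ : ℕ} (r : Ren m₁ n₁) (r' : Ren m₂ n₂) (i : Fin m₂) :
    bsum r r' (Fin.natAdd m₁ i) = Fin.natAdd n₁ (r' i) := by simp [bsum]

theorem swapRen_val (m n : ℕ) (i : Fin (m + n)) :
    (swapRen m n i).val = if i.val < m then n + i.val else i.val - m := by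
  unfold swapRen
  induction i using Fin.addCases <;> simp

theorem copyRen_val (n : ℕ) (i : Fin (n + n)) :
    (copyRen n i).val = if i.val < n then i.val else i.val - n := by
  unfold copyRen
  induction i using Fin.addCases with
  | left i => simp
  | right i => simp only [Fin.addCases_right]; simp

@[simp] theorem idRen_apply (n : ℕ) (i : Fin n) : idRen n i = i := rfl

@[simp] theorem embL_val (n₁ m n₂ : ℕ) (i : Fin n₁) : (embL n₁ m n₂ i).val = i := rfl

@[simp] theorem embM_val (n₁ m n₂ : ℕ) (i : Fin m) : (embM n₁ m n₂ i).val = n₁ + i := rfl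

@[simp] theorem embR_val (n₁ m n₂ : ℕ) (i : Fin n₂) : (embR n₁ m n₂ i).val = n₁ + m + i := rfl

theorem midToLast_val (n₁ n₂ m : ℕ) (i : Fin (n₁ + 1 + n₂)) :
    (midToLast n₁ n₂ m i).val =
      if i.val < n₁ then i.val else if i.val = n₁ then n₁ + m + n₂ else i.val - 1 + m := by
  unfold midToLast
  induction i using Fin.addCases with
  | left i =>
    induction i using Fin.lastCases with
    | last => simp
    | cast i => simp
  | right i =>
    have h₁ : ¬ n₁ + 1 + i.val < n₁ := by omega
    have h₂ : n₁ + 1 + i.val ≠ n₁ := by omega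
    simp [h₁, h₂]
    omega

theorem liftRen_val {m n : ℕ} (r : Fin m → Fin n) (i : Fin (m + 1)) :
    (liftRen r i).val = if h : i.val < m then (r ⟨i, h⟩).val else n := by
  induction i using Fin.lastCases <;> simp

theorem midWeak_val (n : ℕ) (i : Fin (n + 1)) :
    (midWeak n i).val = if i.val < n then i.val else n + 1 := by
  induction i using Fin.lastCases <;> simp

theorem midToLast_of_lt {n₁ n₂ m : ℕ} {i : Fin (n₁ + 1 + n₂)} (h : i.val < n₁) :
    midToLast n₁ n₂ m i = Fin.castSucc ⟨i, by omega⟩ := by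
  ext
  simp [midToLast_val, h]

theorem midToLast_of_eq {n₁ n₂ m : ℕ} {i : Fin (n₁ + 1 + n₂)} (h : i.val = n₁) :
    midToLast n₁ n₂ m i = Fin.last _ := by
  ext
  simp [midToLast_val, h]

theorem midToLast_of_gt {n₁ n₂ m : ℕ} {i : Fin (n₁ + 1 + n₂)} (h : n₁ < i.val) :
    midToLast n₁ n₂ m i = Fin.castSucc ⟨i - 1 + m, by omega⟩ := by
  ext
  simp [midToLast_val, h.ne', h.not_gt]

@[simp] theorem midToLast_left (n₁ n₂ m : ℕ) (i : Fin n₁) :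
    midToLast n₁ n₂ m (Fin.castAdd n₂ (Fin.castAdd 1 i)) = (embL n₁ m n₂ i).castSucc := by
  ext
  simp [midToLast_val]

@[simp] theorem midToLast_mid (n₁ n₂ m : ℕ) (i : Fin 1) :
    midToLast n₁ n₂ m (Fin.castAdd n₂ (Fin.natAdd n₁ i)) = Fin.last _ := by
  ext
  simp [midToLast_val]

@[simp] theorem midToLast_right (n₁ n₂ m : ℕ) (i : Fin n₂) :
    midToLast n₁ n₂ m (Fin.natAdd (n₁ + 1) i) = (embR n₁ m n₂ i).castSucc := by
  simp [midToLast]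

section TermModel

variable {Sg : Sig}

section MidSubst

variable {n₁ n₂ m : ℕ} (V : DVal Sg m)

theorem midSubst_of_lt {i : Fin (n₁ + 1 + n₂)} (h : i.val < n₁) :
    midSubst n₁ n₂ V i = .var ⟨i, by omega⟩ := by
  unfold midSubst
  induction i using Fin.addCases with
  | left i =>
    induction i using Fin.lastCases with
    | last => simp at h
    | cast i => simp; rfl
  | right i => simp at h; omega

theorem midSubst_of_eq {i : Fin (n₁ + 1 + n₂)} (h : i.val = n₁) :
    midSubst n₁ n₂ V i = renameV V (embM n₁ m n₂) := by
  unfold midSubst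
  induction i using Fin.addCases with
  | left i =>
    induction i using Fin.lastCases with
    | last => simp
    | cast i => simp at h; omega
  | right i => simp at h; omega

theorem midSubst_of_gt {i : Fin (n₁ + 1 + n₂)} (h : n₁ < i.val) :
    midSubst n₁ n₂ V i = .var ⟨i - 1 + m, by omega⟩ := by
  unfold midSubst
  induction i using Fin.addCases with
  | left i =>
    induction i using Fin.lastCases with
    | last => simp at h
    | cast i => simp at h; omega
  | right i =>
    simp only [Fin.addCases_right]
    congr 1
    ext
    simp
    omega

@[simp] theorem midSubst_left (i : Fin n₁) :
    midSubst n₁ n₂ V (Fin.castAdd n₂ (Fin.castAdd 1 i)) = .var (embL n₁ m n₂ i) :=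
  midSubst_of_lt V i.isLt

@[simp] theorem midSubst_mid (i : Fin 1) :
    midSubst n₁ n₂ V (Fin.castAdd n₂ (Fin.natAdd n₁ i)) = renameV V (embM n₁ m n₂) :=
  midSubst_of_eq V (by simp)

@[simp] theorem midSubst_right (i : Fin n₂) :
    midSubst n₁ n₂ V (Fin.natAdd (n₁ + 1) i) = .var (embR n₁ m n₂ i) := by
  simp [midSubst]

end MidSubst

theorem EqV.tsub {n₁ n₂ m : ℕ} {V₁ V₁' : DVal Sg (n₁ + 1 + n₂)} {V₂ V₂' : DVal Sg m}
    (h₁ : EqV Sg V₁ V₁') (h₂ : EqV Sg V₂ V₂') :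
    EqV Sg (tsubV n₁ n₂ V₁ V₂) (tsubV n₁ n₂ V₁' V₂') := by
  refine .trans (h₁.subst _) (EqV.subst_right _ fun i => ?_)
  rcases lt_trichotomy i.val n₁ with h | h | h
  · rw [midSubst_of_lt _ h, midSubst_of_lt _ h]
    exact .refl _
  · rw [midSubst_of_eq _ h, midSubst_of_eq _ h]
    exact h₂.rename _
  · rw [midSubst_of_gt _ h, midSubst_of_gt _ h]
    exact .refl _

theorem EqC.tlet {n₁ n₂ m : ℕ} {M₁ M₁' : DCmp Sg (n₁ + 1 + n₂)} {M₂ M₂' : DCmp Sg m}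
    (h₁ : EqC Sg M₁ M₁') (h₂ : EqC Sg M₂ M₂') :
    EqC Sg (tletC n₁ n₂ M₁ M₂) (tletC n₁ n₂ M₁' M₂') :=
  .letin (h₂.rename _) (h₁.rename _)

theorem EqC.tlet_ret {n₁ n₂ m : ℕ} (M : DCmp Sg (n₁ + 1 + n₂)) (V : DVal Sg m) :
    EqC Sg (tletC n₁ n₂ M (.ret V)) (substC M (midSubst n₁ n₂ V)) := by
  unfold tletC
  simp only [renameC]
  refine .trans (.lunit _ _) ?_
  rw [substC_renameC]
  convert EqC.refl _ using 2
  funext i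
  simp only [midSubst, midToLast, Function.comp_apply]
  induction i using Fin.addCases with
  | left i => induction i using Fin.lastCases <;> simp
  | right i => simp

/-- Values modulo provable equality. -/
abbrev QVal (Sg : Sig) (n : ℕ) : Type := Quot (@EqV Sg n)

/-- Computations modulo provable equality. -/
abbrev QCmp (Sg : Sig) (n : ℕ) : Type := Quot (@EqC Sg n)

/-- The class of a value. -/
def mkV {n : ℕ} (V : DVal Sg n) : QVal Sg n := Quot.mk _ V

/-- The class of a computation. -/
def mkC {n : ℕ} (M : DCmp Sg n) : QCmp Sg n := Quot.mk _ M

theorem mkV_surjective {n : ℕ} (q : QVal Sg n) : ∃ V, mkV V = q := Quot.exists_rep q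

theorem mkC_surjective {n : ℕ} (q : QCmp Sg n) : ∃ M, mkC M = q := Quot.exists_rep q

theorem mkV_eq_iff {n : ℕ} {V W : DVal Sg n} : mkV V = mkV W ↔ EqV Sg V W :=
  Equivalence.quot_mk_eq_iff ⟨.refl, .symm, .trans⟩ V W

theorem mkC_eq_iff {n : ℕ} {M N : DCmp Sg n} : mkC M = mkC N ↔ EqC Sg M N :=
  Equivalence.quot_mk_eq_iff ⟨.refl, .symm, .trans⟩ M N

@[simp] theorem acast_mkV {m n : ℕ} (h : m = n) (V : DVal Sg m) :
    acast (C := QVal Sg) h (mkV V) = mkV (renameV V (Fin.cast h)) := by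
  subst h
  exact congrArg mkV (renameV_id V).symm

@[simp] theorem acast_mkC {m n : ℕ} (h : m = n) (M : DCmp Sg m) :
    acast (C := QCmp Sg) h (mkC M) = mkC (renameC M (Fin.cast h)) := by
  subst h
  exact congrArg mkC (renameC_id M).symm

/-- Single substitution on classes of values. -/
def qsubV (n₁ n₂ : ℕ) {m : ℕ} : QVal Sg (n₁ + 1 + n₂) → QVal Sg m → QVal Sg (n₁ + m + n₂) :=
  Quot.map₂ (tsubV n₁ n₂) (fun _ _ _ h => .tsub (.refl _) h) (fun _ _ _ h => .tsub h (.refl _))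

/-- Sequencing on classes of computations. -/
def qletC (n₁ n₂ : ℕ) {m : ℕ} : QCmp Sg (n₁ + 1 + n₂) → QCmp Sg m → QCmp Sg (n₁ + m + n₂) :=
  Quot.map₂ (tletC n₁ n₂) (fun _ _ _ h => .tlet (.refl _) h) (fun _ _ _ h => .tlet h (.refl _))

/-- Renaming on classes of values. -/
def qrenV {m n : ℕ} (q : QVal Sg m) (r : Ren m n) : QVal Sg n :=
  Quot.map (fun V => renameV V r) (fun _ _ h => h.rename r) q

/-- Renaming on classes of computations. -/
def qrenC {m n : ℕ} (q : QCmp Sg m) (r : Ren m n) : QCmp Sg n :=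
  Quot.map (fun M => renameC M r) (fun _ _ h => h.rename r) q

@[simp] theorem qsubV_mk (n₁ n₂ : ℕ) {m : ℕ} (V₁ : DVal Sg (n₁ + 1 + n₂)) (V₂ : DVal Sg m) :
    qsubV n₁ n₂ (mkV V₁) (mkV V₂) = mkV (substV V₁ (midSubst n₁ n₂ V₂)) := rfl

@[simp] theorem qletC_mk (n₁ n₂ : ℕ) {m : ℕ} (M₁ : DCmp Sg (n₁ + 1 + n₂)) (M₂ : DCmp Sg m) :
    qletC n₁ n₂ (mkC M₁) (mkC M₂) =
      mkC (.letin (renameC M₂ (embM n₁ m n₂)) (renameC M₁ (midToLast n₁ n₂ m))) := rfl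

theorem qletC_mk_ret (n₁ n₂ : ℕ) {m : ℕ} (M : DCmp Sg (n₁ + 1 + n₂)) (V : DVal Sg m) :
    qletC n₁ n₂ (mkC M) (mkC (.ret V)) = mkC (substC M (midSubst n₁ n₂ V)) :=
  mkC_eq_iff.2 (.tlet_ret M V)

@[simp] theorem qrenV_mk {m n : ℕ} (V : DVal Sg m) (r : Ren m n) :
    qrenV (mkV V) r = mkV (renameV V r) := rfl

@[simp] theorem qrenC_mk {m n : ℕ} (M : DCmp Sg m) (r : Ren m n) :
    qrenC (mkC M) r = mkC (renameC M r) := rfl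

theorem bsum_id_swap_val (m₁ a b m₂ : ℕ) (i : Fin (m₁ + (a + b) + m₂)) :
    (bsum (bsum (idRen m₁) (swapRen a b)) (idRen m₂) i).val =
      if i.val < m₁ then i.val else if i.val < m₁ + a then i.val + b
      else if i.val < m₁ + (a + b) then i.val - a else i.val := by
  simp [bsum_val, swapRen_val]
  split_ifs <;> omega

theorem bsum_id_copy_val (m₁ n m₂ : ℕ) (i : Fin (m₁ + (n + n) + m₂)) :
    (bsum (bsum (idRen m₁) (copyRen n)) (idRen m₂) i).val =
      if i.val < m₁ + n then i.val else i.val - n := by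
  simp [bsum_val, copyRen_val]
  split_ifs <;> omega

theorem bsum_id_discard_val (m₁ n m₂ : ℕ) (i : Fin (m₁ + 0 + m₂)) :
    (bsum (bsum (idRen m₁) (discardRen n)) (idRen m₂) i).val =
      if i.val < m₁ then i.val else i.val + n := by
  simp [bsum_val]
  split_ifs <;> omega

theorem renameV_congr {m n : ℕ} (V : DVal Sg m) {r s : Fin m → Fin n}
    (h : ∀ i, (r i).val = (s i).val) : renameV V r = renameV V s := by
  rw [show r = s from funext fun i => Fin.ext (h i)]

theorem renameC_congr {m n : ℕ} (M : DCmp Sg m) {r s : Fin m → Fin n}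
    (h : ∀ i, (r i).val = (s i).val) : renameC M r = renameC M s := by
  rw [show r = s from funext fun i => Fin.ext (h i)]

theorem substV_congr {m n : ℕ} (V : DVal Sg m) {σ τ : Fin m → DVal Sg n}
    (h : ∀ i, σ i = τ i) : substV V σ = substV V τ := by
  rw [funext h]

theorem substC_congr {m n : ℕ} (M : DCmp Sg m) {σ τ : Fin m → DVal Sg n}
    (h : ∀ i, σ i = τ i) : substC M σ = substC M τ := by
  rw [funext h]

/-- The renaming preoperad of values modulo provable equality. -/
def termRenV (Sg : Sig) : RenPreoperad where
  C := QVal Sg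
  one := mkV (.var 0)
  subst := qsubV
  ren := qrenV
  left_unit q := by
    obtain ⟨V, rfl⟩ := mkV_surjective q
    simp (disch := simp) only [qsubV_mk, acast_mkV, substV, midSubst_of_eq]
    exact congrArg mkV (renameV_congr _ (by simp))
  right_unit {n₁ n₂} q := by
    obtain ⟨V, rfl⟩ := mkV_surjective q
    simp only [qsubV_mk]
    conv_rhs => rw [← substV_var V]
    refine congrArg mkV (substV_congr _ fun i => ?_)
    rcases lt_trichotomy i.val n₁ with h | h | h
    · simp [midSubst_of_lt _ h]
    · simp [midSubst_of_eq _ h, renameV, Fin.ext_iff, h]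
    · simp [midSubst_of_gt _ h, Fin.ext_iff]
      omega
  assoc {m₁ m₂ n₁ n₂ k} f g h := by
    obtain ⟨f, rfl⟩ := mkV_surjective f
    obtain ⟨g, rfl⟩ := mkV_surjective g
    obtain ⟨h, rfl⟩ := mkV_surjective h
    simp only [qsubV_mk, acast_mkV, renameV_substV, substV_substV]
    refine congrArg mkV (substV_congr _ fun i => ?_)
    rcases lt_trichotomy i.val m₁ with hi | hi | hi
    · simp (disch := (try simp) <;> omega) [midSubst_of_lt, renameV, substV]
    · simp only [midSubst_of_eq _ hi, substV_renameV, renameV_substV, renameV_renameV]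
      refine substV_congr _ fun j => ?_
      rcases lt_trichotomy j.val n₁ with hj | hj | hj
      · simp (disch := (try simp) <;> omega) only
          [midSubst_of_lt, renameV, Function.comp_apply, DVal.var.injEq]
        ext
        simp
      · simp (disch := (try simp) <;> omega) only
          [midSubst_of_eq, renameV_renameV, Function.comp_apply]
        refine renameV_congr _ fun l => ?_
        simp
        omega
      · simp (disch := (try simp) <;> omega) only
          [midSubst_of_gt, renameV, Function.comp_apply, DVal.var.injEq]
        ext
        simp
        omega
    · simp (disch := (try simp) <;> omega) only
        [midSubst_of_gt, renameV, substV, DVal.var.injEq]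
      ext
      simp
      omega
  ren_id q := by
    obtain ⟨V, rfl⟩ := mkV_surjective q
    exact congrArg mkV (renameV_id V)
  ren_comp q r₁ r₂ := by
    obtain ⟨V, rfl⟩ := mkV_surjective q
    simp only [qrenV_mk, renameV_renameV]
  ren_subst f g r₁ r r₂ := by
    obtain ⟨f, rfl⟩ := mkV_surjective f
    obtain ⟨g, rfl⟩ := mkV_surjective g
    simp only [qsubV_mk, qrenV_mk, renameV_substV, substV_renameV]
    refine congrArg mkV (substV_congr _ fun i => ?_)
    simp only [Function.comp_apply]
    induction i using Fin.addCases with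
    | left i =>
      induction i using Fin.addCases with
      | left i => simp only [bsum_castAdd, midSubst_left, renameV, embL]
      | right i =>
        simp only [bsum_castAdd, bsum_natAdd, midSubst_mid, renameV_renameV]
        congr 1
        funext j
        simp only [Function.comp_apply, embM, bsum_castAdd, bsum_natAdd]
    | right i => simp only [bsum_natAdd, midSubst_right, renameV, embR]

/-- The renaming preoperad of computations modulo provable equality. -/
def termRenC (Sg : Sig) : RenPreoperad where
  C := QCmp Sg
  one := mkC (.ret (.var 0))
  subst := qletC
  ren := qrenC
  left_unit q := by
    obtain ⟨M, rfl⟩ := mkC_surjective q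
    simp only [qletC_mk, acast_mkC, renameC, renameV]
    refine mkC_eq_iff.2 (.trans (.runit _) ?_)
    rw [renameC_congr]
    · exact .refl _
    · simp
  right_unit {n₁ n₂} q := by
    obtain ⟨M, rfl⟩ := mkC_surjective q
    rw [qletC_mk_ret]
    conv_rhs => rw [← substC_var M]
    refine congrArg mkC (substC_congr _ fun i => ?_)
    rcases lt_trichotomy i.val n₁ with h | h | h
    · simp [midSubst_of_lt _ h]
    · simp [midSubst_of_eq _ h, renameV, Fin.ext_iff, h]
    · simp [midSubst_of_gt _ h, Fin.ext_iff]
      omega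
  assoc {m₁ m₂ n₁ n₂ k} f g h := by
    obtain ⟨f, rfl⟩ := mkC_surjective f
    obtain ⟨g, rfl⟩ := mkC_surjective g
    obtain ⟨h, rfl⟩ := mkC_surjective h
    simp only [qletC_mk, acast_mkC, renameC, renameC_renameC]
    symm
    refine mkC_eq_iff.2 (.trans (.assoc _ _ _) ?_)
    simp only [renameC_renameC]
    convert EqC.refl _ using 2
    · refine renameC_congr _ fun i => ?_
      simp
      omega
    · congr 1
      · refine renameC_congr _ fun i => ?_
        simp [liftRen_val, midToLast_val]
        split_ifs <;> omega
      · refine renameC_congr _ fun i => ?_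
        simp [liftRen_val, midToLast_val, midWeak_val]
        split_ifs <;> omega
  ren_id q := by
    obtain ⟨M, rfl⟩ := mkC_surjective q
    exact congrArg mkC (renameC_id M)
  ren_comp q r₁ r₂ := by
    obtain ⟨M, rfl⟩ := mkC_surjective q
    simp only [qrenC_mk, renameC_renameC]
  ren_subst f g r₁ r r₂ := by
    obtain ⟨f, rfl⟩ := mkC_surjective f
    obtain ⟨g, rfl⟩ := mkC_surjective g
    simp only [qletC_mk, qrenC_mk, renameC, renameC_renameC]
    congr 3
    · funext i
      simp only [Function.comp_apply, embM, bsum_castAdd, bsum_natAdd]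
    · funext i
      simp only [Function.comp_apply]
      induction i using Fin.addCases with
      | left i =>
        induction i using Fin.addCases with
        | left i => simp only [bsum_castAdd, midToLast_left, liftRen_castSucc, embL]
        | right i => simp only [bsum_castAdd, bsum_natAdd, midToLast_mid, liftRen_last]
      | right i => simp only [bsum_natAdd, midToLast_right, liftRen_castSucc, embR]

/-- The symmetric preoperad of values modulo provable equality. -/
def termSymV (Sg : Sig) : SymRenPreoperad where
  toRenPreoperad := termRenV Sg
  sym_nat₁ {m₁ m₂ n} f g := by
    suffices H : ∀ (ρ : Ren (m₁ + 2 + m₂) (m₁ + 2 + m₂))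
        (τ : Ren (m₁ + (1 + n) + m₂) (m₁ + (n + 1) + m₂)),
        (∀ i, (ρ i).val = if i.val < m₁ then i.val else if i.val < m₁ + 1 then i.val + 1
          else if i.val < m₁ + (1 + 1) then i.val - 1 else i.val) →
        (∀ i, (τ i).val = if i.val < m₁ then i.val else if i.val < m₁ + 1 then i.val + n
          else if i.val < m₁ + (1 + n) then i.val - 1 else i.val) →
        qsubV m₁ (1 + m₂) (acast (C := QVal Sg) (by omega) (qrenV f ρ)) g =
          acast (C := QVal Sg) (by omega)
            (qrenV (acast (C := QVal Sg) (by omega) (qsubV (m₁ + 1) m₂ f g)) τ) from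
      H _ _ (bsum_id_swap_val m₁ 1 1 m₂) (bsum_id_swap_val m₁ 1 n m₂)
    intro ρ τ hρ hτ
    obtain ⟨f, rfl⟩ := mkV_surjective f
    obtain ⟨g, rfl⟩ := mkV_surjective g
    simp only [qsubV_mk, qrenV_mk, acast_mkV, renameV_substV, substV_renameV, renameV_renameV]
    refine congrArg mkV (substV_congr _ fun i => ?_)
    simp only [Function.comp_apply]
    have h := hρ i
    rcases lt_trichotomy (ρ i).val m₁ with h' | h' | h'
    · rw [midSubst_of_lt _ (by simpa using h')]
      rcases lt_or_gt_of_ne (show i.val ≠ m₁ + 1 by split_ifs at h <;> omega) with hi | hi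
      · rw [midSubst_of_lt _ hi]
        simp [renameV, Fin.ext_iff, hτ]
        split_ifs at h ⊢ <;> omega
      · rw [midSubst_of_gt _ hi]
        simp [renameV, Fin.ext_iff, hτ]
        split_ifs at h ⊢ <;> omega
    · rw [midSubst_of_eq _ (by simpa using h'), midSubst_of_eq _ (by split_ifs at h <;> omega),
        renameV_renameV]
      refine renameV_congr _ fun l => ?_
      simp [hτ]
      split_ifs <;> omega
    · rw [midSubst_of_gt _ (by simpa using h')]
      rcases lt_or_gt_of_ne (show i.val ≠ m₁ + 1 by split_ifs at h <;> omega) with hi | hi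
      · rw [midSubst_of_lt _ hi]
        simp [renameV, Fin.ext_iff, hτ]
        split_ifs at h ⊢ <;> omega
      · rw [midSubst_of_gt _ hi]
        simp [renameV, Fin.ext_iff, hτ]
        split_ifs at h ⊢ <;> omega
  sym_nat₂ {m₁ m₂ n} f g := by
    suffices H : ∀ (ρ : Ren (m₁ + 2 + m₂) (m₁ + 1 + 1 + m₂))
        (τ : Ren (m₁ + (n + 1) + m₂) (m₁ + (1 + n) + m₂)),
        (∀ i, (ρ i).val = if i.val < m₁ then i.val else if i.val < m₁ + 1 then i.val + 1
          else if i.val < m₁ + (1 + 1) then i.val - 1 else i.val) →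
        (∀ i, (τ i).val = if i.val < m₁ then i.val else if i.val < m₁ + n then i.val + 1
          else if i.val < m₁ + (n + 1) then i.val - n else i.val) →
        qsubV (m₁ + 1) m₂ (qrenV f ρ) g =
          acast (C := QVal Sg) (by omega)
            (qrenV (acast (C := QVal Sg) (by omega)
              (qsubV m₁ (1 + m₂) (acast (C := QVal Sg) (by omega) f) g)) τ) from
      H _ _ (bsum_id_swap_val m₁ 1 1 m₂) (bsum_id_swap_val m₁ n 1 m₂)
    intro ρ τ hρ hτ
    obtain ⟨f, rfl⟩ := mkV_surjective f
    obtain ⟨g, rfl⟩ := mkV_surjective g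
    simp only [qsubV_mk, qrenV_mk, acast_mkV, renameV_substV, substV_renameV, renameV_renameV]
    refine congrArg mkV (substV_congr _ fun i => ?_)
    simp only [Function.comp_apply]
    have h := hρ i
    rcases lt_trichotomy i.val m₁ with hi | hi | hi
    · rw [midSubst_of_lt _ (by split_ifs at h <;> omega), midSubst_of_lt _ (by simpa using hi)]
      simp [renameV, Fin.ext_iff, hτ, hρ]
      split_ifs <;> omega
    · rw [midSubst_of_eq _ (by split_ifs at h <;> omega), midSubst_of_eq _ (by simpa using hi),
        renameV_renameV]
      refine renameV_congr _ fun l => ?_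
      simp [hτ]
      omega
    · rw [midSubst_of_gt (i := Fin.cast _ i) _ (by simpa using hi)]
      rcases lt_or_gt_of_ne (show (ρ i).val ≠ m₁ + 1 by split_ifs at h <;> omega) with h' | h'
      · rw [midSubst_of_lt _ h']
        simp [renameV, Fin.ext_iff, hτ, hρ]
        split_ifs at h ⊢ <;> omega
      · rw [midSubst_of_gt _ h']
        simp [renameV, Fin.ext_iff, hτ, hρ]
        split_ifs at h ⊢ <;> omega

/-- The symmetric preoperad of computations modulo provable equality. -/
def termSymC (Sg : Sig) : SymRenPreoperad where
  toRenPreoperad := termRenC Sg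
  sym_nat₁ {m₁ m₂ n} f g := by
    suffices H : ∀ (ρ : Ren (m₁ + 2 + m₂) (m₁ + 2 + m₂))
        (τ : Ren (m₁ + (1 + n) + m₂) (m₁ + (n + 1) + m₂)),
        (∀ i, (ρ i).val = if i.val < m₁ then i.val else if i.val < m₁ + 1 then i.val + 1
          else if i.val < m₁ + (1 + 1) then i.val - 1 else i.val) →
        (∀ i, (τ i).val = if i.val < m₁ then i.val else if i.val < m₁ + 1 then i.val + n
          else if i.val < m₁ + (1 + n) then i.val - 1 else i.val) →
        qletC m₁ (1 + m₂) (acast (C := QCmp Sg) (by omega) (qrenC f ρ)) g =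
          acast (C := QCmp Sg) (by omega)
            (qrenC (acast (C := QCmp Sg) (by omega) (qletC (m₁ + 1) m₂ f g)) τ) from
      H _ _ (bsum_id_swap_val m₁ 1 1 m₂) (bsum_id_swap_val m₁ 1 n m₂)
    intro ρ τ hρ hτ
    obtain ⟨f, rfl⟩ := mkC_surjective f
    obtain ⟨g, rfl⟩ := mkC_surjective g
    simp only [qletC_mk, qrenC_mk, acast_mkC, renameC, renameC_renameC]
    congr 2
    · refine renameC_congr _ fun i => ?_
      simp [hτ]
      split_ifs <;> omega
    refine renameC_congr _ fun i => ?_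
    simp only [Function.comp_apply]
    have h := hρ i
    rcases lt_trichotomy (ρ i).val m₁ with h' | h' | h'
    · rw [midToLast_of_lt (by simpa using h')]
      rcases lt_or_gt_of_ne (show i.val ≠ m₁ + 1 by split_ifs at h <;> omega) with hi | hi
      · rw [midToLast_of_lt hi]
        simp only [liftRen_castSucc, Fin.val_castSucc, Fin.val_cast, hτ]
        split_ifs at h ⊢ <;> omega
      · rw [midToLast_of_gt hi]
        simp only [liftRen_castSucc, Fin.val_castSucc, Fin.val_cast, hτ]
        split_ifs at h ⊢ <;> omega
    · rw [midToLast_of_eq (by simpa using h'), midToLast_of_eq (by split_ifs at h <;> omega)]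
      simp
    · rw [midToLast_of_gt (by simpa using h')]
      rcases lt_or_gt_of_ne (show i.val ≠ m₁ + 1 by split_ifs at h <;> omega) with hi | hi
      · rw [midToLast_of_lt hi]
        simp only [liftRen_castSucc, Fin.val_castSucc, Fin.val_cast, hτ]
        split_ifs at h ⊢ <;> omega
      · rw [midToLast_of_gt hi]
        simp only [liftRen_castSucc, Fin.val_castSucc, Fin.val_cast, hτ]
        split_ifs at h ⊢ <;> omega
  sym_nat₂ {m₁ m₂ n} f g := by
    suffices H : ∀ (ρ : Ren (m₁ + 2 + m₂) (m₁ + 1 + 1 + m₂))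
        (τ : Ren (m₁ + (n + 1) + m₂) (m₁ + (1 + n) + m₂)),
        (∀ i, (ρ i).val = if i.val < m₁ then i.val else if i.val < m₁ + 1 then i.val + 1
          else if i.val < m₁ + (1 + 1) then i.val - 1 else i.val) →
        (∀ i, (τ i).val = if i.val < m₁ then i.val else if i.val < m₁ + n then i.val + 1
          else if i.val < m₁ + (n + 1) then i.val - n else i.val) →
        qletC (m₁ + 1) m₂ (qrenC f ρ) g =
          acast (C := QCmp Sg) (by omega)
            (qrenC (acast (C := QCmp Sg) (by omega)
              (qletC m₁ (1 + m₂) (acast (C := QCmp Sg) (by omega) f) g)) τ) from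
      H _ _ (bsum_id_swap_val m₁ 1 1 m₂) (bsum_id_swap_val m₁ n 1 m₂)
    intro ρ τ hρ hτ
    obtain ⟨f, rfl⟩ := mkC_surjective f
    obtain ⟨g, rfl⟩ := mkC_surjective g
    simp only [qletC_mk, qrenC_mk, acast_mkC, renameC, renameC_renameC]
    congr 2
    · refine renameC_congr _ fun i => ?_
      simp [hτ]
      omega
    refine renameC_congr _ fun i => ?_
    simp only [Function.comp_apply]
    have h := hρ i
    rcases lt_trichotomy i.val m₁ with hi | hi | hi
    · rw [midToLast_of_lt (by split_ifs at h <;> omega), midToLast_of_lt (by simpa using hi)]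
      simp only [liftRen_castSucc, Fin.val_castSucc, Fin.val_cast, hτ]
      split_ifs at h ⊢ <;> omega
    · rw [midToLast_of_eq (by split_ifs at h <;> omega), midToLast_of_eq (by simpa using hi)]
      simp
    · rw [midToLast_of_gt (i := Fin.cast _ i) (by simpa using hi)]
      rcases lt_or_gt_of_ne (show (ρ i).val ≠ m₁ + 1 by split_ifs at h <;> omega) with h' | h'
      · rw [midToLast_of_lt h']
        simp only [liftRen_castSucc, Fin.val_castSucc, Fin.val_cast, hτ]
        split_ifs at h ⊢ <;> omega
      · rw [midToLast_of_gt h']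
        simp only [liftRen_castSucc, Fin.val_castSucc, Fin.val_cast, hτ]
        split_ifs at h ⊢ <;> omega

theorem termSymV_subst_comm {k₁ k₂ : ℕ} (g₁ : (termSymV Sg).C k₁) (g₂ : (termSymV Sg).C k₂)
    (m₁ m m₂ : ℕ) (f : (termSymV Sg).C (m₁ + 1 + m + 1 + m₂)) :
    (termSymV Sg).subst (m₁ + k₁ + m) m₂
        (acast (C := (termSymV Sg).C) (by omega)
          ((termSymV Sg).subst m₁ (m + 1 + m₂)
            (acast (C := (termSymV Sg).C) (by omega) f) g₁)) g₂ =
      acast (C := (termSymV Sg).C) (by omega)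
        ((termSymV Sg).subst m₁ (m + k₂ + m₂)
          (acast (C := (termSymV Sg).C) (by omega)
            ((termSymV Sg).subst (m₁ + 1 + m) m₂ f g₂)) g₁) := by
  obtain ⟨f, rfl⟩ := mkV_surjective f
  obtain ⟨g₁, rfl⟩ := mkV_surjective g₁
  obtain ⟨g₂, rfl⟩ := mkV_surjective g₂
  simp only [termSymV, termRenV, qsubV_mk, acast_mkV, renameV_substV, substV_substV,
    substV_renameV]
  refine congrArg mkV (substV_congr _ fun i => ?_)
  simp only [Function.comp_apply]
  rcases lt_trichotomy i.val m₁ with hi | hi | hi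
  · rw [midSubst_of_lt (i := Fin.cast _ i) _ (by simpa using hi),
      midSubst_of_lt (i := i) _ (by omega)]
    simp only [substV, Function.comp_apply]
    rw [midSubst_of_lt _ (by simp; omega), midSubst_of_lt _ (by simp; omega)]
    rfl
  · rw [midSubst_of_eq (i := Fin.cast _ i) _ (by simpa using hi),
      midSubst_of_lt (i := i) _ (by omega)]
    simp only [substV, substV_renameV]
    rw [midSubst_of_eq _ (by simpa using hi), renameV_renameV, renameV_eq_substV]
    refine substV_congr _ fun j => ?_
    simp only [Function.comp_apply]
    rw [midSubst_of_lt _ (by simp; omega)]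
    simp [Fin.ext_iff]
  · rw [midSubst_of_gt (i := Fin.cast _ i) _ (by simpa using hi)]
    simp only [substV, Function.comp_apply]
    rcases lt_trichotomy i.val (m₁ + 1 + m) with hj | hj | hj
    · rw [midSubst_of_lt (i := i) _ hj, midSubst_of_lt _ (by simp; omega)]
      simp only [substV]
      rw [midSubst_of_gt _ (by simpa using hi)]
      simp [renameV]
    · rw [midSubst_of_eq (i := i) _ hj, midSubst_of_eq _ (by simp; omega), substV_renameV,
        renameV_eq_substV]
      refine substV_congr _ fun j => ?_
      simp only [Function.comp_apply]
      rw [midSubst_of_gt _ (by simp; omega)]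
      simp [renameV, Fin.ext_iff]
      omega
    · rw [midSubst_of_gt (i := i) _ hj, midSubst_of_gt _ (by simp; omega)]
      simp only [substV]
      rw [midSubst_of_gt _ (by simp; omega)]
      simp [renameV, Fin.ext_iff]
      omega

/-- The cartesian operad of values modulo provable equality. -/
def termV (Sg : Sig) : CartOperad where
  toSymRenPreoperad := termSymV Sg
  central g₁ _ g₂ m₁ m m₂ f :=
    ⟨termSymV_subst_comm g₁ g₂ m₁ m m₂ f, termSymV_subst_comm g₂ g₁ m₁ m m₂ f⟩
  discard_nat {m₁ m₂ n} f g := by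
    suffices H : ∀ (ρ : Ren (m₁ + 0 + m₂) (m₁ + 1 + m₂)) (τ : Ren (m₁ + 0 + m₂) (m₁ + n + m₂)),
        (∀ i, (ρ i).val = if i.val < m₁ then i.val else i.val + 1) →
        (∀ i, (τ i).val = if i.val < m₁ then i.val else i.val + n) →
        qsubV m₁ m₂ (qrenV f ρ) g = qrenV f τ from
      H _ _ (bsum_id_discard_val m₁ 1 m₂) (bsum_id_discard_val m₁ n m₂)
    intro ρ τ hρ hτ
    obtain ⟨f, rfl⟩ := mkV_surjective f
    obtain ⟨g, rfl⟩ := mkV_surjective g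
    simp only [qsubV_mk, qrenV_mk, substV_renameV, renameV_eq_substV f τ]
    refine congrArg mkV (substV_congr _ fun i => ?_)
    simp only [Function.comp_apply]
    have h := hρ i
    rcases lt_or_gt_of_ne (show (ρ i).val ≠ m₁ by split_ifs at h <;> omega) with h' | h'
    · simp only [midSubst_of_lt _ h', DVal.var.injEq, Fin.ext_iff, hτ]
      split_ifs at h ⊢ <;> omega
    · simp only [midSubst_of_gt _ h', DVal.var.injEq, Fin.ext_iff, hτ]
      split_ifs at h ⊢ <;> omega
  copy_nat {m₁ m₂ n} f g := by
    suffices H : ∀ (ρ : Ren (m₁ + 2 + m₂) (m₁ + 1 + m₂))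
        (τ : Ren (m₁ + (n + n) + m₂) (m₁ + n + m₂)),
        (∀ i, (ρ i).val = if i.val < m₁ + 1 then i.val else i.val - 1) →
        (∀ i, (τ i).val = if i.val < m₁ + n then i.val else i.val - n) →
        qsubV m₁ m₂ (qrenV f ρ) g =
          qrenV (acast (C := QVal Sg) (by omega)
            (qsubV m₁ (n + m₂) (acast (C := QVal Sg) (by omega) (qsubV (m₁ + 1) m₂ f g)) g)) τ from
      H _ _ (bsum_id_copy_val m₁ 1 m₂) (bsum_id_copy_val m₁ n m₂)
    intro ρ τ hρ hτ
    obtain ⟨f, rfl⟩ := mkV_surjective f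
    obtain ⟨g, rfl⟩ := mkV_surjective g
    simp only [qsubV_mk, qrenV_mk, acast_mkV, renameV_substV, substV_substV, substV_renameV]
    refine congrArg mkV (substV_congr _ fun i => ?_)
    simp only [Function.comp_apply]
    have h := hρ i
    rcases lt_trichotomy i.val (m₁ + 1) with hi | hi | hi
    · rw [if_pos hi] at h
      rw [midSubst_of_lt (n₁ := m₁ + 1) _ hi]
      simp only [substV]
      rcases Nat.lt_succ_iff_lt_or_eq.1 hi with hj | hj
      · rw [midSubst_of_lt (i := ρ i) _ (by omega),
          midSubst_of_lt (i := Fin.cast _ _) _ (by simpa using hj)]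
        simp only [renameV, DVal.var.injEq, Fin.ext_iff, hτ, Fin.val_cast]
        split_ifs <;> omega
      · rw [midSubst_of_eq (i := ρ i) _ (by omega),
          midSubst_of_eq (i := Fin.cast _ _) _ (by simpa using hj), renameV_renameV,
          renameV_renameV]
        refine renameV_congr _ fun l => ?_
        simp [hτ]
    · rw [midSubst_of_eq (i := ρ i) _ (by split_ifs at h <;> omega), midSubst_of_eq (i := i) _ hi,
        substV_renameV, renameV_eq_substV]
      refine substV_congr _ fun l => ?_
      simp only [Function.comp_apply]
      rw [midSubst_of_gt _ (by simp; omega)]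
      simp only [renameV, DVal.var.injEq, Fin.ext_iff, hτ, Fin.val_cast, embM_val]
      split_ifs <;> omega
    · rw [midSubst_of_gt (i := ρ i) _ (by split_ifs at h <;> omega), midSubst_of_gt (i := i) _ hi]
      simp only [substV]
      rw [midSubst_of_gt _ (by simp; omega)]
      simp only [renameV, DVal.var.injEq, Fin.ext_iff, hτ, Fin.val_cast]
      split_ifs at h ⊢ <;> omega

theorem liftRen_cast {m n : ℕ} (h : m = n) :
    liftRen (Fin.cast h) = Fin.cast (congrArg Nat.succ h) := by
  subst h
  funext i
  induction i using Fin.lastCases <;> simp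

/-- Returning a value, on classes. -/
def qret {n : ℕ} (q : QVal Sg n) : QCmp Sg n := Quot.map .ret (fun _ _ h => .ret h) q

/-- Abstraction, on classes. -/
def qlam {n : ℕ} (q : QCmp Sg (n + 1)) : QVal Sg n := Quot.map .lam (fun _ _ h => .lam h) q

@[simp] theorem qret_mk {n : ℕ} (V : DVal Sg n) : qret (mkV V) = mkC (.ret V) := rfl

@[simp] theorem qlam_mk {n : ℕ} (M : DCmp Sg (n + 1)) : qlam (mkC M) = mkV (.lam M) := rfl

theorem qlet_ret_comm_right {k₁ k₂ : ℕ} (V : QVal Sg k₁) (N : QCmp Sg k₂) (m₁ m m₂ : ℕ)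
    (f : QCmp Sg (m₁ + 1 + m + 1 + m₂)) :
    qletC (m₁ + k₁ + m) m₂
        (acast (C := QCmp Sg) (by omega)
          (qletC m₁ (m + 1 + m₂) (acast (C := QCmp Sg) (by omega) f) (qret V))) N =
      acast (C := QCmp Sg) (by omega)
        (qletC m₁ (m + k₂ + m₂)
          (acast (C := QCmp Sg) (by omega) (qletC (m₁ + 1 + m) m₂ f N)) (qret V)) := by
  obtain ⟨f, rfl⟩ := mkC_surjective f
  obtain ⟨V, rfl⟩ := mkV_surjective V
  obtain ⟨N, rfl⟩ := mkC_surjective N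
  rw [qret_mk, acast_mkC, qletC_mk_ret, acast_mkC, qletC_mk, qletC_mk, acast_mkC, qletC_mk_ret,
    acast_mkC]
  simp only [renameC, substC, renameC_substC, substC_renameC]
  congr 2
  · rw [renameC_eq_substC]
    refine substC_congr _ fun i => ?_
    simp only [Function.comp_apply]
    rw [midSubst_of_gt _ (by simp; omega)]
    simp [renameV, Fin.ext_iff]
    omega
  refine substC_congr _ fun i => ?_
  simp only [Function.comp_apply]
  rcases lt_trichotomy i.val m₁ with hi | hi | hi
  · rw [midSubst_of_lt (i := Fin.cast _ i) _ (by simpa using hi), midToLast_of_lt (by omega)]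
    simp only [liftRen_castSucc, liftSub_castSucc, renameV]
    rw [midSubst_of_lt _ (by simpa using hi), midToLast_of_lt (by simp; omega)]
    simp [renameV, liftRen_cast]
  · rw [midSubst_of_eq (i := Fin.cast _ i) _ (by simpa using hi), midToLast_of_lt (by omega)]
    simp only [liftRen_castSucc, liftSub_castSucc, renameV_renameV]
    rw [midSubst_of_eq _ (by simpa using hi)]
    simp only [renameV_renameV]
    refine renameV_congr _ fun l => ?_
    simp only [Function.comp_apply]
    rw [midToLast_of_lt (by simp; omega)]
    simp
  · rw [midSubst_of_gt (i := Fin.cast _ i) _ (by simpa using hi)]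
    simp only [renameV]
    rcases lt_trichotomy i.val (m₁ + 1 + m) with hj | hj | hj
    · rw [midToLast_of_lt hj, midToLast_of_lt (by simp; omega)]
      simp only [liftRen_castSucc, liftSub_castSucc]
      rw [midSubst_of_gt _ (by simpa using hi)]
      simp [renameV, liftRen_cast]
    · rw [midToLast_of_eq hj, midToLast_of_eq (by simp; omega)]
      simp [renameV, liftRen_cast]
    · rw [midToLast_of_gt hj, midToLast_of_gt (by simp; omega)]
      simp only [liftRen_castSucc, liftSub_castSucc]
      rw [midSubst_of_gt _ (by simp; omega)]
      simp [renameV, Fin.ext_iff, liftRen_cast]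
      omega

theorem qlet_ret_comm_left {k₁ k₂ : ℕ} (N : QCmp Sg k₁) (V : QVal Sg k₂) (m₁ m m₂ : ℕ)
    (f : QCmp Sg (m₁ + 1 + m + 1 + m₂)) :
    qletC (m₁ + k₁ + m) m₂
        (acast (C := QCmp Sg) (by omega)
          (qletC m₁ (m + 1 + m₂) (acast (C := QCmp Sg) (by omega) f) N)) (qret V) =
      acast (C := QCmp Sg) (by omega)
        (qletC m₁ (m + k₂ + m₂)
          (acast (C := QCmp Sg) (by omega) (qletC (m₁ + 1 + m) m₂ f (qret V))) N) := by
  obtain ⟨f, rfl⟩ := mkC_surjective f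
  obtain ⟨V, rfl⟩ := mkV_surjective V
  obtain ⟨N, rfl⟩ := mkC_surjective N
  rw [qret_mk, acast_mkC, qletC_mk, acast_mkC, qletC_mk_ret, qletC_mk_ret, acast_mkC, qletC_mk,
    acast_mkC]
  simp only [renameC, substC, renameC_substC, substC_renameC]
  congr 2
  · rw [renameC_renameC, renameC_eq_substC]
    refine substC_congr _ fun i => ?_
    simp only [Function.comp_apply]
    rw [midSubst_of_lt _ (by simp; omega)]
    simp [Fin.ext_iff]
  refine substC_congr _ fun i => ?_
  simp only [Function.comp_apply]
  rcases lt_trichotomy i.val m₁ with hi | hi | hi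
  · rw [midSubst_of_lt (i := i) _ (by omega), midToLast_of_lt (by simpa using hi)]
    simp only [liftRen_castSucc, liftSub_castSucc, renameV]
    rw [midSubst_of_lt _ (by simp; omega), midToLast_of_lt (by simpa using hi)]
    simp [renameV, liftRen_cast]
  · rw [midSubst_of_lt (i := i) _ (by omega), midToLast_of_eq (by simpa using hi)]
    simp only [renameV]
    rw [midToLast_of_eq (by simpa using hi)]
    simp
  · rw [midToLast_of_gt (i := Fin.cast _ i) (by simpa using hi)]
    simp only [liftRen_castSucc, liftSub_castSucc]
    rcases lt_trichotomy i.val (m₁ + 1 + m) with hj | hj | hj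
    · rw [midSubst_of_lt _ hj, midSubst_of_lt _ (by simp; omega)]
      simp only [renameV]
      rw [midToLast_of_gt (by simpa using hi)]
      simp [liftRen_cast]
    · rw [midSubst_of_eq _ hj, midSubst_of_eq _ (by simp; omega)]
      simp only [renameV_renameV]
      refine renameV_congr _ fun l => ?_
      simp only [Function.comp_apply]
      rw [midToLast_of_gt (by simp; omega)]
      simp [liftRen_cast]
      omega
    · rw [midSubst_of_gt _ hj, midSubst_of_gt _ (by simp; omega)]
      simp only [renameV]
      rw [midToLast_of_gt (by simp; omega)]
      simp [Fin.ext_iff, liftRen_cast]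
      omega

/-- The Freyd operad of values and computations modulo provable equality. -/
def termFreyd (Sg : Sig) : FreydOperad where
  V := termV Sg
  C := termSymC Sg
  I :=
    { map := qret
      map_one := rfl
      map_subst := fun f g => by
        obtain ⟨f, rfl⟩ := mkV_surjective f
        obtain ⟨g, rfl⟩ := mkV_surjective g
        exact (qletC_mk_ret _ _ (.ret f) g).symm
      map_ren := fun f r => by
        obtain ⟨f, rfl⟩ := mkV_surjective f
        rfl }
  I_central v _ g m₁ m m₂ f :=
    ⟨qlet_ret_comm_right v g m₁ m m₂ f, qlet_ret_comm_left g v m₁ m m₂ f⟩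

/-- The weakly closed Freyd operad of values and computations modulo provable equality. -/
def termWC (Sg : Sig) : WCFreydOperad where
  toFreydOperad := termFreyd Sg
  abs := qlam
  app := mkC (.app (.var 0) (.var 1))
  beta {n} f := by
    obtain ⟨f, rfl⟩ := mkC_surjective f
    refine (qletC_mk_ret 0 1 _ _).trans ?_
    refine Eq.trans ?_ (acast_mkC _ _).symm
    simp only [substC, substV]
    rw [midSubst_of_eq _ (by simp), midSubst_of_gt _ (by simp)]
    simp only [renameV]
    refine mkC_eq_iff.2 (.trans (.beta _ _) ?_)
    rw [substC_renameC, renameC_eq_substC]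
    convert EqC.refl _ using 1
    refine substC_congr _ fun i => ?_
    simp only [Function.comp_apply]
    induction i using Fin.lastCases with
    | last => simp [Fin.ext_iff]
    | cast i => simp [Fin.ext_iff]
  abs_subst {m₁ m₂ k} f v := by
    obtain ⟨f, rfl⟩ := mkC_surjective f
    obtain ⟨v, rfl⟩ := mkV_surjective v
    refine Eq.trans (congrArg (fun q => qlam (acast _ q)) (qletC_mk_ret m₁ (m₂ + 1) f v)) ?_
    refine Eq.trans (congrArg qlam (acast_mkC _ _)) ?_
    refine Eq.trans ?_ (congrArg (fun q => qsubV m₁ m₂ (qlam q) (mkV v))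
      (acast_mkC (by omega) f)).symm
    simp only [qlam_mk, qsubV_mk, substV, substC_renameC, renameC_substC]
    refine congrArg (fun M => mkV (.lam M)) (substC_congr _ fun i => ?_)
    simp only [Function.comp_apply]
    rcases lt_trichotomy i.val m₁ with hi | hi | hi
    · rw [midSubst_of_lt _ hi]
      have : Fin.cast (show m₁ + 1 + (m₂ + 1) = m₁ + 1 + m₂ + 1 by omega) i =
          Fin.castSucc ⟨i, by omega⟩ := rfl
      rw [this, liftSub_castSucc, midSubst_of_lt _ (by simpa using hi)]
      simp [renameV]
    · rw [midSubst_of_eq _ hi]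
      have : Fin.cast (show m₁ + 1 + (m₂ + 1) = m₁ + 1 + m₂ + 1 by omega) i =
          Fin.castSucc ⟨i, by omega⟩ := rfl
      rw [this, liftSub_castSucc, midSubst_of_eq _ (by simpa using hi), renameV_renameV, renameV_renameV]
      refine renameV_congr _ fun l => ?_
      simp
    · rw [midSubst_of_gt _ hi]
      rcases Nat.lt_succ_iff_lt_or_eq.1 (show i.val < m₁ + 1 + m₂ + 1 by omega) with hj | hj
      · have : Fin.cast (show m₁ + 1 + (m₂ + 1) = m₁ + 1 + m₂ + 1 by omega) i =
            Fin.castSucc ⟨i, hj⟩ := rfl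
        rw [this, liftSub_castSucc, midSubst_of_gt _ (by simpa using hi)]
        simp [renameV]
      · have : Fin.cast (show m₁ + 1 + (m₂ + 1) = m₁ + 1 + m₂ + 1 by omega) i =
            Fin.last _ := Fin.ext hj
        rw [this, liftSub_last]
        simp [renameV, Fin.ext_iff]
        omega

/-- The term model: values and computations modulo provable equality. -/
def termModel (Sg : Sig) : CLCStructure Sg where
  O := termWC Sg
  Ff f := mkV (.func f fun i => .var i)
  Pp p := mkC (.proc p fun i => .var i)

/-- The substitution placing the value `g i` in the `i`-th block, fixing a trailing block. -/
def blockSubst {n : ℕ} (k : Fin n → ℕ) (t : ℕ) (g : ∀ i, DVal Sg (k i)) (i : Fin (n + t)) :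
    DVal Sg (finSum k + t) :=
  Fin.addCases (fun i => renameV (g i) (Fin.castAdd t ∘ blockInj k i))
    (fun j => .var (Fin.natAdd (finSum k) j)) i

theorem blockSubst_castAdd {n : ℕ} (k : Fin n → ℕ) (t : ℕ) (g : ∀ i, DVal Sg (k i)) (i : Fin n) :
    blockSubst k t g (Fin.castAdd t i) = renameV (g i) (Fin.castAdd t ∘ blockInj k i) :=
  Fin.addCases_left i

theorem blockSubst_natAdd {n : ℕ} (k : Fin n → ℕ) (t : ℕ) (g : ∀ i, DVal Sg (k i)) (j : Fin t) :
    blockSubst k t g (Fin.natAdd n j) = .var (Fin.natAdd (finSum k) j) :=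
  Fin.addCases_right j

theorem blockInj_last {n : ℕ} (k : Fin (n + 1) → ℕ) (a : Fin (k (Fin.last n))) :
    blockInj k (Fin.last n) a = Fin.natAdd (finSum fun j => k j.castSucc) a :=
  congrFun (Fin.lastCases_last (motive := fun i => Fin (k i) → Fin (finSum k))) a

theorem blockInj_castSucc {n : ℕ} (k : Fin (n + 1) → ℕ) (i : Fin n) (a : Fin (k i.castSucc)) :
    blockInj k i.castSucc a =
      Fin.castAdd (k (Fin.last n)) (blockInj (fun j => k j.castSucc) i a) :=
  congrFun (Fin.lastCases_castSucc (motive := fun i => Fin (k i) → Fin (finSum k)) i) a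

theorem blockSubst_succ {n : ℕ} (k : Fin (n + 1) → ℕ) (t : ℕ) (g : ∀ i, DVal Sg (k i))
    (h₁ : n + k (Fin.last n) + t = n + (k (Fin.last n) + t))
    (h₂ : finSum (fun i => k i.castSucc) + (k (Fin.last n) + t) = finSum k + t)
    (i : Fin (n + 1 + t)) :
    renameV (substV (renameV (midSubst n t (g (Fin.last n)) i) (Fin.cast h₁))
      (blockSubst (fun i => k i.castSucc) (k (Fin.last n) + t) fun i => g i.castSucc))
        (Fin.cast h₂) = blockSubst k t g i := by
  induction i using Fin.addCases with
  | left i =>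
    induction i using Fin.lastCases with
    | last =>
      rw [midSubst_of_eq _ (by simp)]
      rw [renameV_renameV, substV_renameV, renameV_substV, blockSubst_castAdd, renameV_eq_substV]
      refine substV_congr _ fun l => ?_
      have : Fin.cast h₁ (embM n (k (Fin.last n)) t l) = Fin.natAdd n (Fin.castAdd t l) := by
        ext
        simp
      simp only [Function.comp_apply, this, blockSubst_natAdd, renameV, blockInj_last]
      simp [Fin.ext_iff]
      rfl
    | cast i =>
      rw [midSubst_of_lt _ (by simp)]
      have : Fin.cast h₁ ⟨(Fin.castAdd t i.castSucc).val, by simp; omega⟩ =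
          Fin.castAdd (k (Fin.last n) + t) i := by
        ext
        simp
      simp only [renameV, substV, this, blockSubst_castAdd, renameV_renameV]
      refine renameV_congr _ fun l => ?_
      simp [blockInj_castSucc]
      rfl
  | right i =>
    rw [midSubst_of_gt _ (by simp; omega)]
    have : Fin.cast h₁ ⟨(Fin.natAdd (n + 1) i).val - 1 + k (Fin.last n), by simp; omega⟩ =
        Fin.natAdd n (Fin.natAdd (k (Fin.last n)) i) := by
      ext
      simp
      omega
    simp only [renameV, substV]
    rw [this, blockSubst_natAdd, blockSubst_natAdd]
    exact congrArg DVal.var (Fin.ext (Nat.add_assoc _ _ _).symm)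

theorem psubAux_mkV {n : ℕ} (k : Fin n → ℕ) (t : ℕ) (V : DVal Sg (n + t))
    (g : ∀ i, DVal Sg (k i)) :
    (termV Sg).toPreoperad.psubAux k t (mkV V) (fun i => mkV (g i)) =
      mkV (substV V (blockSubst k t g)) := by
  induction n generalizing t with
  | zero =>
    refine congrArg mkV ?_
    refine (substV_var V).symm.trans (substV_congr _ fun i => ?_)
    induction i using Fin.addCases with
    | left i => exact i.elim0
    | right j => exact (blockSubst_natAdd k t g j).symm
  | succ n ih =>
    refine Eq.trans (congrArg (fun q => acast _ ((termV Sg).toPreoperad.psubAux _ _ q _))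
      (acast_mkV _ (substV V (midSubst n t (g (Fin.last n)))))) ?_
    rw [ih]
    refine (acast_mkV _ _).trans (congrArg mkV ?_)
    rw [renameV_substV V, substV_substV, renameV_substV]
    exact substV_congr _ fun i => blockSubst_succ k t g _ _ i

theorem psubAux_mkC {n : ℕ} (k : Fin n → ℕ) (t : ℕ) (M : DCmp Sg (n + t))
    (g : ∀ i, DVal Sg (k i)) :
    (termSymC Sg).toPreoperad.psubAux k t (mkC M) (fun i => mkC (.ret (g i))) =
      mkC (substC M (blockSubst k t g)) := by
  induction n generalizing t with
  | zero =>
    refine congrArg mkC ?_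
    refine (substC_var M).symm.trans (substC_congr _ fun i => ?_)
    induction i using Fin.addCases with
    | left i => exact i.elim0
    | right j => exact (blockSubst_natAdd k t g j).symm
  | succ n ih =>
    refine Eq.trans (congrArg (fun q => acast _ ((termSymC Sg).toPreoperad.psubAux _ _ q _))
      ((congrArg (acast _) (qletC_mk_ret n t M (g (Fin.last n)))).trans (acast_mkC _ _))) ?_
    rw [ih]
    refine (acast_mkC _ _).trans (congrArg mkC ?_)
    rw [renameC_substC M, substC_substC, renameC_substC]
    exact substC_congr _ fun i => blockSubst_succ k t g _ _ i

theorem finSumCases_blockInj {n : ℕ} (k : Fin n → ℕ) {α : Type*} (h : ∀ i, Fin (k i) → α)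
    (i : Fin n) (a : Fin (k i)) : finSumCases k h (blockInj k i a) = h i a := by
  induction n with
  | zero => exact i.elim0
  | succ n ih =>
    induction i using Fin.lastCases with
    | last =>
      rw [blockInj_last]
      exact Fin.addCases_right a
    | cast i =>
      rw [blockInj_castSucc]
      exact (Fin.addCases_left _).trans (ih (fun j => k j.castSucc) (fun j => h j.castSucc) i a)

theorem renameV_blockSubst {n m : ℕ} (g : Fin n → DVal Sg m) (i : Fin n) :
    renameV (blockSubst (fun _ => m) 0 g i) (finSumCases (fun _ => m) fun _ a => a) = g i := by
  have : blockSubst (fun _ => m) 0 g i = renameV (g i) (blockInj (fun _ => m) i) :=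
    blockSubst_castAdd (fun _ => m) 0 g i
  rw [this, renameV_renameV]
  refine Eq.trans (renameV_congr _ fun a => ?_) (renameV_id (g i))
  simp [finSumCases_blockInj]

theorem ren_psub_mkV {n m : ℕ} (V : DVal Sg n) (g : Fin n → DVal Sg m) :
    (termV Sg).ren ((termV Sg).toPreoperad.psub (fun _ => m) (mkV V) fun i => mkV (g i))
      (finSumCases (fun _ => m) fun _ a => a) = mkV (substV V g) := by
  refine Eq.trans (congrArg (fun q => qrenV q _) (psubAux_mkV (fun _ => m) 0 V g)) ?_
  refine (qrenV_mk _ _).trans (congrArg mkV ?_)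
  exact (renameV_substV _ _ _).trans (substV_congr _ (renameV_blockSubst g))

theorem ren_psub_mkC {n m : ℕ} (M : DCmp Sg n) (g : Fin n → DVal Sg m) :
    (termSymC Sg).ren
      ((termSymC Sg).toPreoperad.psub (fun _ => m) (mkC M) fun i => mkC (.ret (g i)))
      (finSumCases (fun _ => m) fun _ a => a) = mkC (substC M g) := by
  refine Eq.trans (congrArg (fun q => qrenC q _) (psubAux_mkC (fun _ => m) 0 M g)) ?_
  refine (qrenC_mk _ _).trans (congrArg mkC ?_)
  exact (renameC_substC _ _ _).trans (substC_congr _ (renameV_blockSubst g))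

mutual

theorem interpV_termModel : ∀ {n : ℕ} (V : DVal Sg n), interpV (termModel Sg) V = mkV V
  | _, .var _ => rfl
  | n, .func f args => by
    simp only [interpV, interpV_termModel]
    exact ren_psub_mkV (.func f fun i => .var i) args
  | _, .lam M => by
    simp only [interpV, interpC_termModel]
    rfl

theorem interpC_termModel : ∀ {n : ℕ} (M : DCmp Sg n), interpC (termModel Sg) M = mkC M
  | _, .ret W => by
    simp only [interpC, interpV_termModel]
    rfl
  | n, .letin M₁ M₂ => by
    simp only [interpC, interpC_termModel M₁, interpC_termModel M₂]
    refine congrArg mkC ?_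
    simp only [tletC, renameC, renameC_renameC]
    congr 1
    · refine Eq.trans (renameC_congr _ fun i => ?_) (renameC_id M₁)
      simp [copyRen_val]
    · refine Eq.trans (renameC_congr _ fun i => ?_) (renameC_id M₂)
      induction i using Fin.lastCases with
      | last =>
        simp only [Function.comp_apply]
        rw [midToLast_of_eq (by simp)]
        simp
      | cast i =>
        simp only [Function.comp_apply]
        rw [midToLast_of_lt (by simp), liftRen_castSucc]
        simp [copyRen_val]
  | n, .proc p args => by
    simp only [interpC, interpV_termModel]
    exact ren_psub_mkC (.proc p fun i => .var i) args
  | n, .app V₁ V₂ => by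
    simp only [interpC, interpV_termModel V₁, interpV_termModel V₂]
    have h : (fun i : Fin 2 => (termModel Sg).O.I.map
        (Fin.cases (motive := fun _ => QVal Sg n) (mkV V₁) (fun _ => mkV V₂) i)) =
        fun i => mkC (.ret (Fin.cases (motive := fun _ => DVal Sg n) V₁ (fun _ => V₂) i)) := by
      funext i
      cases i using Fin.cases <;> rfl
    refine Eq.trans (congrArg (fun q => (termSymC Sg).ren
      ((termSymC Sg).toPreoperad.psub (fun _ => n) _ q) _) h) ?_
    exact ren_psub_mkC (.app (.var 0) (.var 1)) _

end

end TermModel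

/-- **completeness.** If `⟦t₁⟧ = ⟦t₂⟧` in every λ_CLC-structure (for
well-formed terms of the same sort in context `Γ`), then `Γ ⊢ t₁ ≡ t₂` is derivable in
the equational theory of λ_CLC. -/
theorem stmt19 {Sg : Sig} :
    (∀ {n : ℕ} (V₁ V₂ : DVal Sg n),
      (∀ S : CLCStructure Sg, interpV S V₁ = interpV S V₂) → EqV Sg V₁ V₂) ∧
    (∀ {n : ℕ} (M₁ M₂ : DCmp Sg n),
      (∀ S : CLCStructure Sg, interpC S M₁ = interpC S M₂) → EqC Sg M₁ M₂) := by
  exact ⟨fun V₁ V₂ h => mkV_eq_iff.1 <| by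
      rw [← interpV_termModel V₁, ← interpV_termModel V₂, h],
    fun M₁ M₂ h => mkC_eq_iff.1 <| by
      rw [← interpC_termModel M₁, ← interpC_termModel M₂, h]⟩
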